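/- arXiv:2312.17514 — 3 statements merged into one kernel-verified Lean document; each statement's English description precedes it below -/
import Mathlib

section
/- Let d ≥ 2 and let p₁ and p₂ be harmonic homogeneous polynomials on ℝ^d of degrees ℓ₁ and ℓ₂ respectively. Then: (i) there exist harmonic homogeneous polynomials h_ℓ of degree ℓ, one for each integer ℓ with |ℓ₁ − ℓ₂| ≤ ℓ ≤ ℓ₁ + ℓ₂, such that p₁(y)·p₂(y) = Σ_{ℓ=|ℓ₁−ℓ₂|}^{ℓ₁+ℓ₂} h_ℓ(y) for every y ∈ S^{d−1}; and (ii) for every harmonic homogeneous polynomial p₃ of degree ℓ₃ with either ℓ₃ < |ℓ₁ − ℓ₂| or ℓ₃ > ℓ₁ + ℓ₂, one has ∫_{S^{d−1}} p₁ p₂ p₃ dσ = 0. -/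
open MeasureTheory MvPolynomial

/-- Evaluation of a polynomial on `ℝ^d` at a point of the unit sphere. -/
noncomputable def sphereEval {d : ℕ} (p : MvPolynomial (Fin d) ℝ)
    (y : Metric.sphere (0 : EuclideanSpace ℝ (Fin d)) 1) : ℝ :=
  MvPolynomial.eval (fun i => (y : EuclideanSpace ℝ (Fin d)) i) p

/-- `p` is a harmonic polynomial, homogeneous of degree `k`, on `ℝ^d`. -/
def IsHarmHom (d : ℕ) (p : MvPolynomial (Fin d) ℝ) (k : ℕ) : Prop :=
  p.IsHomogeneous k ∧ ∑ i : Fin d, pderiv i (pderiv i p) = 0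

/-- The surface measure on the unit sphere of `ℝ^d`. -/
noncomputable def sphereMeasure (d : ℕ) :
    Measure (Metric.sphere (0 : EuclideanSpace ℝ (Fin d)) 1) :=
  (volume : Measure (EuclideanSpace ℝ (Fin d))).toSphere

noncomputable def lapl (d : ℕ) : MvPolynomial (Fin d) ℝ →ₗ[ℝ] MvPolynomial (Fin d) ℝ :=
  ∑ i : Fin d, (pderiv i).toLinearMap ∘ₗ (pderiv i).toLinearMap

lemma lapl_apply {d : ℕ} (p : MvPolynomial (Fin d) ℝ) :
    lapl d p = ∑ i : Fin d, pderiv i (pderiv i p) := by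
  simp [lapl, LinearMap.sum_apply]

lemma pderiv_comm' {d : ℕ} (i j : Fin d) (p : MvPolynomial (Fin d) ℝ) :
    pderiv i (pderiv j p) = pderiv j (pderiv i p) := by
  have : ⁅(pderiv i : Derivation ℝ (MvPolynomial (Fin d) ℝ) (MvPolynomial (Fin d) ℝ)),
      (pderiv j : Derivation ℝ (MvPolynomial (Fin d) ℝ) (MvPolynomial (Fin d) ℝ))⁆ = 0 := by
    apply MvPolynomial.derivation_ext
    intro k
    rw [Derivation.commutator_apply]
    simp [pderiv_X, Pi.single_apply]
    split_ifs <;> simp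
  have h2 := congrArg (fun D => D p) this
  simp only [Derivation.commutator_apply] at h2
  exact sub_eq_zero.mp h2

lemma lapl_pderiv {d : ℕ} (i : Fin d) (p : MvPolynomial (Fin d) ℝ) :
    lapl d (pderiv i p) = pderiv i (lapl d p) := by
  simp only [lapl_apply, map_sum]
  refine Finset.sum_congr rfl fun j _ => ?_
  rw [pderiv_comm' j i, pderiv_comm' j i]

lemma lapl_mul {d : ℕ} (p q : MvPolynomial (Fin d) ℝ) :
    lapl d (p * q) = lapl d p * q + 2 * ∑ i, pderiv i p * pderiv i q + p * lapl d q := by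
  simp only [lapl_apply, Finset.sum_mul, Finset.mul_sum, ← Finset.sum_add_distrib]
  refine Finset.sum_congr rfl fun j _ => ?_
  simp only [pderiv_mul, map_add]
  ring

lemma lapl_hom {d n : ℕ} {p : MvPolynomial (Fin d) ℝ} (hp : p.IsHomogeneous n) :
    (lapl d p).IsHomogeneous (n - 2) := by
  rw [lapl_apply]
  refine IsHomogeneous.sum _ _ _ fun i _ => ?_
  exact hp.pderiv.pderiv

lemma lapl_pow_hom {d n : ℕ} {p : MvPolynomial (Fin d) ℝ} (hp : p.IsHomogeneous n) (m : ℕ) :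
    ((lapl d ^ m) p).IsHomogeneous (n - 2 * m) := by
  induction m with
  | zero => simpa using hp
  | succ m ih =>
    rw [pow_succ', Module.End.mul_apply]
    have := lapl_hom ih
    rwa [show n - 2 * (m + 1) = n - 2 * m - 2 by omega]

lemma lapl_pow_mul_eq_zero {d : ℕ} (a : ℕ) : ∀ (p q : MvPolynomial (Fin d) ℝ),
    p.IsHomogeneous a → lapl d p = 0 → lapl d q = 0 → (lapl d ^ (a + 1)) (p * q) = 0 := by
  induction a with
  | zero =>
    intro p q hp h1 h2
    have : p = C (coeff 0 p) := totalDegree_eq_zero_iff_eq_C.mp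
      ((totalDegree_zero_iff_isHomogeneous _).mpr hp)
    rw [zero_add, pow_one, lapl_mul, h1, h2, this]
    simp
  | succ a ih =>
    intro p q hp h1 h2
    rw [pow_succ, Module.End.mul_apply, lapl_mul, h1, h2]
    have : (lapl d ^ (a + 1)) (∑ i, pderiv i p * pderiv i q) = 0 := by
      rw [map_sum]
      refine Finset.sum_eq_zero fun i _ => ih _ _ ?_ ?_ ?_
      · simpa using hp.pderiv (i := i)
      · rw [lapl_pderiv, h1, map_zero]
      · rw [lapl_pderiv, h2, map_zero]
    rw [zero_mul, mul_zero, zero_add, add_zero, two_mul, map_add, this, add_zero]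

noncomputable def rsq (d : ℕ) : MvPolynomial (Fin d) ℝ := ∑ i, X i ^ 2

lemma rsq_hom (d : ℕ) : (rsq d).IsHomogeneous 2 :=
  IsHomogeneous.sum _ _ _ fun i _ => isHomogeneous_X_pow i 2

lemma pderiv_rsq {d : ℕ} (i : Fin d) : pderiv i (rsq d) = 2 * X i := by
  simp only [rsq, map_sum]
  rw [Finset.sum_eq_single i]
  · simp [pderiv_pow]
  · intro j _ hj
    simp [pderiv_pow, pderiv_X_of_ne hj]
  · simp

lemma lapl_rsq (d : ℕ) : lapl d (rsq d) = C (2 * d : ℝ) := by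
  rw [lapl_apply]
  have h : ∀ i : Fin d, pderiv i (2 * X i : MvPolynomial (Fin d) ℝ) = 2 := by
    intro i
    rw [← map_ofNat C 2, pderiv_C_mul]; simp [smul_eq_C_mul]
  simp only [pderiv_rsq, h]
  simp [mul_comm]
  exact Or.inl (map_ofNat C 2).symm

lemma lapl_rsq_mul {d n : ℕ} {f : MvPolynomial (Fin d) ℝ} (hf : f.IsHomogeneous n) :
    lapl d (rsq d * f) = rsq d * lapl d f + (4 * n + 2 * d : ℝ) • f := by
  rw [lapl_mul, lapl_rsq]
  simp only [pderiv_rsq, mul_assoc, ← Finset.mul_sum]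
  rw [hf.sum_X_mul_pderiv, smul_eq_C_mul]
  simp only [nsmul_eq_mul, map_add, map_mul, map_natCast, map_ofNat]
  ring

lemma lapl_rsq_pow_mul {d s : ℕ} (hd : 0 < d) {q : MvPolynomial (Fin d) ℝ}
    (hq : q.IsHomogeneous s) (h0 : lapl d q = 0) (j : ℕ) :
    ∃ c : ℝ, 0 < c ∧ lapl d (rsq d ^ (j + 1) * q) = c • (rsq d ^ j * q) := by
  induction j with
  | zero =>
    refine ⟨4 * s + 2 * d, by positivity, ?_⟩
    rw [zero_add, pow_one, lapl_rsq_mul hq, h0]; simp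
  | succ j ih =>
    obtain ⟨c, hc, h⟩ := ih
    refine ⟨c + (4 * ((2 * (j + 1) + s : ℕ) : ℝ) + 2 * d), by positivity, ?_⟩
    rw [pow_succ' _ (j + 1), mul_assoc, lapl_rsq_mul (((rsq_hom d).pow (j + 1)).mul hq), h,
      add_smul c, pow_succ' _ j, mul_smul_comm, mul_assoc]

lemma lapl_pow_rsq_pow_mul {d s : ℕ} (hd : 0 < d) {q : MvPolynomial (Fin d) ℝ}
    (hq : q.IsHomogeneous s) (h0 : lapl d q = 0) (j : ℕ) :
    ∃ c : ℝ, 0 < c ∧ (lapl d ^ j) (rsq d ^ j * q) = c • q := by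
  induction j with
  | zero => exact ⟨1, one_pos, by simp⟩
  | succ j ih =>
    obtain ⟨c, hc, h⟩ := ih
    obtain ⟨c', hc', h'⟩ := lapl_rsq_pow_mul hd hq h0 j
    refine ⟨c' * c, by positivity, ?_⟩
    rw [pow_succ (lapl d), Module.End.mul_apply, h', map_smul, h, smul_smul]

lemma sphereEval_rsq {d : ℕ} (y : Metric.sphere (0 : EuclideanSpace ℝ (Fin d)) 1) :
    sphereEval (rsq d) y = 1 := by
  have h : ‖(y : EuclideanSpace ℝ (Fin d))‖ = 1 := by simp
  have h2 := EuclideanSpace.real_norm_sq_eq (y : EuclideanSpace ℝ (Fin d))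
  rw [h] at h2
  simp [sphereEval, rsq, ← h2]

lemma decomp {d : ℕ} (hd : 0 < d) (n m : ℕ) : 2 * m ≤ n → ∀ (p : MvPolynomial (Fin d) ℝ),
    p.IsHomogeneous n → (lapl d ^ (m + 1)) p = 0 →
    ∃ h : ℕ → MvPolynomial (Fin d) ℝ, (∀ ℓ, IsHarmHom d (h ℓ) ℓ) ∧
      (∀ ℓ < n - 2 * m, h ℓ = 0) ∧
      ∀ y, sphereEval p y = ∑ ℓ ∈ Finset.range (n + 1), sphereEval (h ℓ) y := by
  have single_harm : ∀ (k : ℕ) (q : MvPolynomial (Fin d) ℝ), q.IsHomogeneous k → lapl d q = 0 →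
      ∀ ℓ, IsHarmHom d ((Pi.single k q : ℕ → MvPolynomial (Fin d) ℝ) ℓ) ℓ := by
    intro k q hq h0 ℓ
    by_cases hk : ℓ = k
    · subst hk
      rw [Pi.single_eq_same]
      exact ⟨hq, by rw [← lapl_apply, h0]⟩
    · rw [Pi.single_eq_of_ne hk]
      exact ⟨isHomogeneous_zero _ _ _, by simp⟩
  have single_sum : ∀ (k : ℕ) (q : MvPolynomial (Fin d) ℝ) (y), k ≤ n →
      ∑ ℓ ∈ Finset.range (n + 1), sphereEval ((Pi.single k q : ℕ → MvPolynomial (Fin d) ℝ) ℓ) y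
        = sphereEval q y := by
    intro k q y hk
    rw [Finset.sum_eq_single k]
    · simp
    · intro b _ hb
      rw [Pi.single_eq_of_ne hb]; simp [sphereEval]
    · intro h; simp at h; omega
  induction m with
  | zero =>
    intro _ p hp h0
    refine ⟨Pi.single n p, single_harm _ _ hp (by simpa using h0), ?_, ?_⟩
    · intro ℓ hℓ
      exact Pi.single_eq_of_ne (by omega) _
    · intro y
      rw [single_sum _ _ _ le_rfl]
  | succ m ih =>
    intro hm p hp h0
    set q := (lapl d ^ (m + 1)) p with hqdef
    have hq : q.IsHomogeneous (n - 2 * (m + 1)) := lapl_pow_hom hp _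
    have hq0 : lapl d q = 0 := by
      rw [pow_succ', Module.End.mul_apply] at h0; exact h0
    obtain ⟨c, hc, h⟩ := lapl_pow_rsq_pow_mul hd hq hq0 (m + 1)
    have hq' : (c⁻¹ • q).IsHomogeneous (n - 2 * (m + 1)) := by
      rw [smul_eq_C_mul]
      simpa using (isHomogeneous_C (Fin d) c⁻¹).mul hq
    have hr : (rsq d ^ (m + 1) * (c⁻¹ • q)).IsHomogeneous n := by
      have := ((rsq_hom d).pow (m + 1)).mul hq'
      rwa [show 2 * (m + 1) + (n - 2 * (m + 1)) = n by omega] at this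
    obtain ⟨g, hg1, hg2, hg3⟩ := ih (by omega) (p - rsq d ^ (m + 1) * (c⁻¹ • q))
      (hp.sub hr) (by
        rw [map_sub, mul_smul_comm, map_smul, h, smul_smul, inv_mul_cancel₀ hc.ne', one_smul,
          ← hqdef, sub_self])
    refine ⟨g + Pi.single (n - 2 * (m + 1)) (c⁻¹ • q), ?_, ?_, ?_⟩
    · intro ℓ
      have h1 := hg1 ℓ
      have h2 := single_harm _ _ hq' (by rw [map_smul, hq0, smul_zero]) ℓ
      refine ⟨h1.1.add h2.1, ?_⟩
      rw [← lapl_apply, Pi.add_apply, map_add, lapl_apply, lapl_apply, h1.2, h2.2, add_zero]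
    · intro ℓ hℓ
      rw [Pi.add_apply, hg2 ℓ (by omega), Pi.single_eq_of_ne (by omega), add_zero]
    · intro y
      have e1 := hg3 y
      have e2 := single_sum (n - 2 * (m + 1)) (c⁻¹ • q) y (by omega)
      have e3 := sphereEval_rsq y
      simp only [sphereEval, Pi.add_apply, map_add, map_sub, map_mul, map_pow,
        Finset.sum_add_distrib] at *
      rw [e2, ← e1, e3]
      ring

lemma part_one (d : ℕ) (hd : 2 ≤ d) (ℓ₁ ℓ₂ : ℕ)
    (p₁ p₂ : MvPolynomial (Fin d) ℝ)
    (h₁ : IsHarmHom d p₁ ℓ₁) (h₂ : IsHarmHom d p₂ ℓ₂) :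
    (∃ h : ℕ → MvPolynomial (Fin d) ℝ,
      (∀ ℓ, IsHarmHom d (h ℓ) ℓ) ∧
      ∀ y : Metric.sphere (0 : EuclideanSpace ℝ (Fin d)) 1,
        sphereEval p₁ y * sphereEval p₂ y
          = ∑ ℓ ∈ Finset.Icc (max ℓ₁ ℓ₂ - min ℓ₁ ℓ₂) (ℓ₁ + ℓ₂), sphereEval (h ℓ) y) := by
  have key : (lapl d ^ (min ℓ₁ ℓ₂ + 1)) (p₁ * p₂) = 0 := by
    have e1 : lapl d p₁ = 0 := by rw [lapl_apply, h₁.2]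
    have e2 : lapl d p₂ = 0 := by rw [lapl_apply, h₂.2]
    rcases le_total ℓ₁ ℓ₂ with h | h
    · rw [min_eq_left h]; exact lapl_pow_mul_eq_zero _ _ _ h₁.1 e1 e2
    · rw [min_eq_right h, mul_comm]; exact lapl_pow_mul_eq_zero _ _ _ h₂.1 e2 e1
  obtain ⟨h, a, b, c⟩ := decomp (by omega) (ℓ₁ + ℓ₂) (min ℓ₁ ℓ₂) (by omega) _
    (h₁.1.mul h₂.1) key
  refine ⟨h, a, fun y => ?_⟩
  have := c y
  rw [show sphereEval (p₁ * p₂) y = sphereEval p₁ y * sphereEval p₂ y by simp [sphereEval]] at this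
  rw [this]
  symm
  apply Finset.sum_subset
  · intro ℓ hℓ; simp at hℓ ⊢; omega
  · intro ℓ h1 h2
    simp at h1 h2
    rw [b ℓ (by omega)]; simp [sphereEval]

noncomputable def pe {d : ℕ} (p : MvPolynomial (Fin d) ℝ) (x : EuclideanSpace ℝ (Fin d)) : ℝ :=
  MvPolynomial.eval (fun i => x i) p

noncomputable def gw {d : ℕ} (b : ℝ) (x : EuclideanSpace ℝ (Fin d)) : ℝ := Real.exp (-b * ‖x‖ ^ 2)

lemma hasFDerivAt_pe {d : ℕ} (p : MvPolynomial (Fin d) ℝ) (x : EuclideanSpace ℝ (Fin d)) :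
    HasFDerivAt (pe p) (∑ i, pe (pderiv i p) x •
      (EuclideanSpace.proj i : EuclideanSpace ℝ (Fin d) →L[ℝ] ℝ)) x := by
  induction p using MvPolynomial.induction_on with
  | C a =>
    have : pe (d := d) (C a) = fun _ => a := by funext x; simp [pe]
    rw [this]
    simpa [pe] using hasFDerivAt_const (𝕜 := ℝ) a x
  | add p q hp hq =>
    have : pe (p + q) = fun x => pe p x + pe q x := by funext x; simp [pe]
    rw [this]
    convert! hp.add hq using 1
    rw [← Finset.sum_add_distrib]
    refine Finset.sum_congr rfl fun i _ => ?_
    rw [← add_smul]; simp [pe]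
  | mul_X p j hp =>
    have : pe (p * X j) = fun x => pe p x * (EuclideanSpace.proj j : EuclideanSpace ℝ (Fin d) →L[ℝ] ℝ) x := by
      funext x; simp [pe]
    rw [this]
    convert! hp.mul (EuclideanSpace.proj j : EuclideanSpace ℝ (Fin d) →L[ℝ] ℝ).hasFDerivAt using 1
    ext v
    simp [pe, pderiv_mul, pderiv_X, Pi.single_apply, add_mul, Finset.sum_add_distrib,
      Finset.mul_sum, mul_ite, ite_mul, apply_ite]
    refine Finset.sum_congr rfl fun i _ => ?_
    ring

lemma continuous_pe {d : ℕ} (p : MvPolynomial (Fin d) ℝ) : Continuous (pe p) :=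
  continuous_iff_continuousAt.mpr fun x => (hasFDerivAt_pe p x).continuousAt

lemma continuous_gw {d : ℕ} (b : ℝ) : Continuous (gw (d := d) b) := by
  unfold gw; fun_prop

lemma fderiv_pe {d : ℕ} (p : MvPolynomial (Fin d) ℝ) (x : EuclideanSpace ℝ (Fin d)) (i : Fin d) :
    fderiv ℝ (pe p) x (EuclideanSpace.single i 1) = pe (pderiv i p) x := by
  rw [(hasFDerivAt_pe p x).fderiv]
  simp [Pi.single_apply]

lemma hasFDerivAt_gw {d : ℕ} (x : EuclideanSpace ℝ (Fin d)) :
    HasFDerivAt (gw 1) (gw 1 x • ((-1 : ℝ) • (2 • innerSL ℝ x))) x := by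
  unfold gw
  exact (((hasStrictFDerivAt_norm_sq x).hasFDerivAt).const_mul (-1 : ℝ)).exp

lemma fderiv_gw {d : ℕ} (x : EuclideanSpace ℝ (Fin d)) (i : Fin d) :
    fderiv ℝ (gw 1) x (EuclideanSpace.single i 1) = - 2 * x i * gw 1 x := by
  rw [(hasFDerivAt_gw x).fderiv]
  simp [EuclideanSpace.inner_single_right]
  ring

lemma integrable_gw {d : ℕ} {b : ℝ} (hb : 0 < b) : Integrable (gw (d := d) b) := by
  have := (GaussianFourier.integrable_cexp_neg_mul_sq_norm_add (V := EuclideanSpace ℝ (Fin d))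
    (b := (b : ℂ)) (by simpa using hb) 0 0).norm
  refine this.congr (Filter.Eventually.of_forall fun x => ?_)
  simp only [Complex.norm_exp, gw]
  congr 1
  simp [← Complex.ofReal_pow]

lemma integrable_pe_gw {d : ℕ} (p : MvPolynomial (Fin d) ℝ) :
    ∀ {b : ℝ}, 0 < b → Integrable (fun x => pe p x * gw b x) := by
  induction p using MvPolynomial.induction_on with
  | C a =>
    intro b hb
    simpa [pe] using (integrable_gw (d := d) hb).const_mul a
  | add p q hp hq =>
    intro b hb
    have : (fun x => pe (p + q) x * gw b x) = fun x => pe p x * gw b x + pe q x * gw b x := by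
      funext x; simp [pe, add_mul]
    rw [this]
    exact (hp hb).add (hq hb)
  | mul_X p j hp =>
    intro b hb
    have : (fun x => pe (p * X j) x * gw b x)
        = fun x => (pe p x * gw (b / 2) x) * (x j * gw (b / 2) x) := by
      funext x
      have : gw b x = gw (b / 2) x * gw (b / 2) x := by
        rw [gw, gw, ← Real.exp_add]; congr 1; ring
      rw [this]; simp [pe]; ring
    rw [this]
    refine (hp (half_pos hb)).mul_bdd (c := 1 + 2 / b) ?_ ?_
    · refine Continuous.aestronglyMeasurable ?_
      have := continuous_gw (d := d) (b / 2)
      fun_prop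
    · refine Filter.Eventually.of_forall fun x => ?_
      have h1 : ‖x j‖ ≤ ‖x‖ := PiLp.norm_apply_le x j
      have h2 : b / 2 * ‖x‖ ^ 2 + 1 ≤ Real.exp (b / 2 * ‖x‖ ^ 2) := Real.add_one_le_exp _
      have h3 : gw (b / 2) x = (Real.exp (b / 2 * ‖x‖ ^ 2))⁻¹ := by
        rw [gw, ← Real.exp_neg]; congr 1; ring
      have h0 : 0 < Real.exp (b / 2 * ‖x‖ ^ 2) := Real.exp_pos _
      rw [norm_mul, h3, norm_inv, Real.norm_of_nonneg h0.le, ← div_eq_mul_inv, div_le_iff₀ h0]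
      have h4 : ‖x‖ ≤ (1 + 2 / b) * (b / 2 * ‖x‖ ^ 2 + 1) := by
        have : (1 + 2 / b) * (b / 2 * ‖x‖ ^ 2 + 1)
          = b / 2 * ‖x‖ ^ 2 + ‖x‖ ^ 2 + 1 + 2 / b := by field_simp; ring
        rw [this]
        have : 0 ≤ b / 2 * ‖x‖ ^ 2 := by positivity
        have : 0 < 2 / b := by positivity
        nlinarith [sq_nonneg (‖x‖ - 1), norm_nonneg x]
      calc ‖x j‖ ≤ ‖x‖ := h1
        _ ≤ _ := h4
        _ ≤ _ := by gcongr

noncomputable def J (d : ℕ) : MvPolynomial (Fin d) ℝ →ₗ[ℝ] ℝ where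
  toFun p := ∫ x, pe p x * gw 1 x
  map_add' p q := by
    rw [← integral_add (integrable_pe_gw p one_pos) (integrable_pe_gw q one_pos)]
    congr 1; funext x; simp [pe, add_mul]
  map_smul' c p := by
    rw [RingHom.id_apply, smul_eq_mul, ← integral_const_mul]
    congr 1; funext x; simp [pe, mul_assoc]

lemma J_parts {d : ℕ} (p : MvPolynomial (Fin d) ℝ) (i : Fin d) :
    J d (pderiv i p) = 2 * J d (X i * p) := by
  have e1 : (fun x => fderiv ℝ (pe p) x (EuclideanSpace.single i 1) * gw 1 x)
      = fun x => pe (pderiv i p) x * gw 1 x := by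
    funext x; rw [fderiv_pe]
  have e2 : (fun x => pe p x * fderiv ℝ (gw 1) x (EuclideanSpace.single i 1))
      = fun x => (-2) * (pe (X i * p) x * gw 1 x) := by
    funext x; rw [fderiv_gw]; simp [pe]; ring
  have := integral_mul_fderiv_eq_neg_fderiv_mul_of_integrable (𝕜 := ℝ)
    (μ := (volume : Measure (EuclideanSpace ℝ (Fin d))))
    (f := pe p) (g := gw 1) (v := EuclideanSpace.single i 1)
    (by rw [e1]; exact integrable_pe_gw _ one_pos)
    (by rw [e2]; exact (integrable_pe_gw _ one_pos).const_mul _)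
    (integrable_pe_gw _ one_pos)
    (fun x _ => (hasFDerivAt_pe p x).differentiableAt)
    (fun x _ => (hasFDerivAt_gw x).differentiableAt)
  rw [e1, e2, integral_const_mul] at this
  simp only [J, LinearMap.coe_mk, AddHom.coe_mk]
  linarith

lemma J_grad {d k : ℕ} {h g : MvPolynomial (Fin d) ℝ} (hh : IsHarmHom d h k) :
    J d (∑ i, pderiv i h * pderiv i g) = 2 * k * J d (h * g) := by
  have key : ∀ i, J d (pderiv i h * pderiv i g)
      = 2 * J d (X i * pderiv i h * g) - J d (pderiv i (pderiv i h) * g) := by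
    intro i
    have := J_parts (pderiv i h * g) i
    rw [pderiv_mul, map_add, ← mul_assoc] at this
    linarith
  rw [map_sum, Finset.sum_congr rfl fun i _ => key i, Finset.sum_sub_distrib, ← Finset.mul_sum,
    ← map_sum, ← map_sum, ← Finset.sum_mul, ← Finset.sum_mul, hh.2, hh.1.sum_X_mul_pderiv,
    zero_mul, map_zero, smul_mul_assoc, map_nsmul, nsmul_eq_mul]
  ring

lemma J_orth {d k l : ℕ} {h g : MvPolynomial (Fin d) ℝ} (hh : IsHarmHom d h k)
    (hg : IsHarmHom d g l) (hkl : k ≠ l) : J d (h * g) = 0 := by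
  have e1 := J_grad (g := g) hh
  have e2 := J_grad (g := h) hg
  rw [mul_comm g h, Finset.sum_congr rfl fun i _ => mul_comm _ _, e1] at e2
  have hne : (k : ℝ) - l ≠ 0 := sub_ne_zero.mpr (by exact_mod_cast hkl)
  have : ((k : ℝ) - l) * J d (h * g) = 0 := by linarith
  exact (mul_eq_zero.mp this).resolve_left hne

lemma pe_smul {d k : ℕ} {p : MvPolynomial (Fin d) ℝ} (hp : p.IsHomogeneous k) (r : ℝ)
    (x : EuclideanSpace ℝ (Fin d)) : pe p (r • x) = r ^ k * pe p x := by
  simp only [pe, MvPolynomial.eval_eq', Finset.mul_sum]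
  refine Finset.sum_congr rfl fun m hm => ?_
  have hdeg : ∑ i, m i = k := by
    have := hp (mem_support_iff.mp hm)
    rw [Finsupp.weight_apply, Finsupp.sum_fintype _ _ (by simp)] at this
    simpa using this
  simp only [PiLp.smul_apply, smul_eq_mul, mul_pow, Finset.prod_mul_distrib,
    Finset.prod_pow_eq_pow_sum, hdeg]
  ring

lemma J_polar {d k : ℕ} (hd : 2 ≤ d) {p : MvPolynomial (Fin d) ℝ} (hp : p.IsHomogeneous k) :
    ∃ c : ℝ, 0 < c ∧ J d p = (∫ y, sphereEval p y ∂(sphereMeasure d)) * c := by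
  refine ⟨∫ r : Set.Ioi (0 : ℝ), (r : ℝ) ^ k * Real.exp (-1 * (r : ℝ) ^ 2)
    ∂(Measure.volumeIoiPow (Module.finrank ℝ (EuclideanSpace ℝ (Fin d)) - 1)), ?_, ?_⟩
  · simp only [Measure.volumeIoiPow, ENNReal.ofReal]
    set m := Module.finrank ℝ (EuclideanSpace ℝ (Fin d)) - 1
    rw [integral_withDensity_eq_integral_smul ((measurable_subtype_coe.pow_const _).real_toNNReal),
      integral_subtype_comap measurableSet_Ioi
        fun a : ℝ ↦ Real.toNNReal (a ^ m) • (a ^ k * Real.exp (-1 * a ^ 2)),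
      setIntegral_congr_fun (g := fun a : ℝ => a ^ ((m + k : ℕ) : ℝ) * Real.exp (-1 * a ^ (2 : ℝ)))
        measurableSet_Ioi fun x hx ↦ ?_]
    · rw [integral_rpow_mul_exp_neg_mul_rpow two_pos
        (lt_of_lt_of_le (by norm_num) (Nat.cast_nonneg _)) one_pos]
      have := Real.Gamma_pos_of_pos (s := (((m + k : ℕ) : ℝ) + 1) / 2) (by positivity)
      positivity
    · simp only
      rw [NNReal.smul_def, Real.coe_toNNReal _ (pow_nonneg hx.out.le _), Real.rpow_natCast,
        smul_eq_mul, ← mul_assoc, ← pow_add]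
      norm_cast
  · let F : EuclideanSpace ℝ (Fin d) → ℝ := fun x => pe p x * gw 1 x
    have : Nonempty (Fin d) := ⟨⟨0, by omega⟩⟩
    have : Nontrivial (EuclideanSpace ℝ (Fin d)) := inferInstance
    rw [sphereMeasure, ← integral_prod_mul]
    rw [← (volume : Measure (EuclideanSpace ℝ (Fin d))).measurePreserving_homeomorphUnitSphereProd.integral_comp
        (Homeomorph.measurableEmbedding _)]
    show ∫ x, F x = _
    have hF : ∫ x, F x = ∫ x : ({(0)}ᶜ : Set (EuclideanSpace ℝ (Fin d))), F x.1
        ∂((volume : Measure (EuclideanSpace ℝ (Fin d))).comap (↑)) := by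
      rw [integral_subtype_comap (measurableSet_singleton _).compl F, restrict_compl_singleton]
    rw [hF]
    congr 1
    funext x
    have hx : (x : EuclideanSpace ℝ (Fin d)) ≠ 0 := x.2
    have hn : ‖(x : EuclideanSpace ℝ (Fin d))‖ ≠ 0 := norm_ne_zero_iff.mpr hx
    have : (x : EuclideanSpace ℝ (Fin d)) = ‖(x : EuclideanSpace ℝ (Fin d))‖ •
        ((homeomorphUnitSphereProd _ x).1 : EuclideanSpace ℝ (Fin d)) := by
      simp [smul_smul, hn]
    have e : pe p x = ‖(x : EuclideanSpace ℝ (Fin d))‖ ^ k *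
        sphereEval p (homeomorphUnitSphereProd _ x).1 := by
      conv_lhs => rw [this, pe_smul hp]
      rfl
    simp only [F, e, gw, homeomorphUnitSphereProd_apply_snd_coe]
    ring

lemma sphere_orth {d k l : ℕ} (hd : 2 ≤ d) {h g : MvPolynomial (Fin d) ℝ} (hh : IsHarmHom d h k)
    (hg : IsHarmHom d g l) (hkl : k ≠ l) :
    ∫ y, sphereEval h y * sphereEval g y ∂(sphereMeasure d) = 0 := by
  obtain ⟨c, hc, e⟩ := J_polar hd (hh.1.mul hg.1)
  rw [J_orth hh hg hkl] at e
  have := (mul_eq_zero.mp e.symm).resolve_right hc.ne'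
  simpa [sphereEval] using this

lemma integrable_sphere {d : ℕ} (p q : MvPolynomial (Fin d) ℝ) :
    Integrable (fun y => sphereEval p y * sphereEval q y) (sphereMeasure d) := by
  have : IsFiniteMeasure (sphereMeasure d) := by unfold sphereMeasure; infer_instance
  have hc : ∀ p : MvPolynomial (Fin d) ℝ, Continuous (sphereEval p) := fun p =>
    (continuous_pe p).comp continuous_subtype_val
  have : CompactSpace (Metric.sphere (0 : EuclideanSpace ℝ (Fin d)) 1) := inferInstance
  exact ((hc p).mul (hc q)).integrable_of_hasCompactSupport (HasCompactSupport.of_compactSpace _)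

theorem stmt0 (d : ℕ) (hd : 2 ≤ d) (ℓ₁ ℓ₂ : ℕ)
    (p₁ p₂ : MvPolynomial (Fin d) ℝ)
    (h₁ : IsHarmHom d p₁ ℓ₁) (h₂ : IsHarmHom d p₂ ℓ₂) :
    (∃ h : ℕ → MvPolynomial (Fin d) ℝ,
      (∀ ℓ ∈ Finset.Icc (max ℓ₁ ℓ₂ - min ℓ₁ ℓ₂) (ℓ₁ + ℓ₂), IsHarmHom d (h ℓ) ℓ) ∧
      ∀ y : Metric.sphere (0 : EuclideanSpace ℝ (Fin d)) 1,
        sphereEval p₁ y * sphereEval p₂ y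
          = ∑ ℓ ∈ Finset.Icc (max ℓ₁ ℓ₂ - min ℓ₁ ℓ₂) (ℓ₁ + ℓ₂), sphereEval (h ℓ) y) ∧
    (∀ (ℓ₃ : ℕ) (p₃ : MvPolynomial (Fin d) ℝ), IsHarmHom d p₃ ℓ₃ →
      (ℓ₃ < max ℓ₁ ℓ₂ - min ℓ₁ ℓ₂ ∨ ℓ₁ + ℓ₂ < ℓ₃) →
      ∫ y : Metric.sphere (0 : EuclideanSpace ℝ (Fin d)) 1,
        sphereEval p₁ y * sphereEval p₂ y * sphereEval p₃ y ∂(sphereMeasure d) = 0) := by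
  obtain ⟨h, hh, he⟩ := part_one d hd ℓ₁ ℓ₂ p₁ p₂ h₁ h₂
  refine ⟨⟨h, fun ℓ _ => hh ℓ, he⟩, fun ℓ₃ p₃ h₃ hl => ?_⟩
  simp only [he, Finset.sum_mul]
  rw [integral_finsetSum _ fun ℓ _ => integrable_sphere (h ℓ) p₃]
  refine Finset.sum_eq_zero fun ℓ hℓ => sphere_orth hd (hh ℓ) h₃ ?_
  rw [Finset.mem_Icc] at hℓ
  omega
end

section
/- Let d ≥ 2 and s > d/2 + 1/2. There exists a constant C > 0, depending only on s and d, such that the following holds for every κ > 0 and every sequence β : ℕ → (0,∞) which is easing with factor κ, i.e. for all i, j, k ∈ ℕ, k ≤ i + j implies β_k ≤ κ β_i β_j. For every L ∈ ℕ and all families (u_ℓ)_{0≤ℓ≤L}, (v_ℓ)_{0≤ℓ≤L}, (w_ℓ)_{0≤ℓ≤2L}, where u_ℓ, v_ℓ and w_ℓ are spherical harmonics of degree ℓ on S^{d−1}, if (Σ_{ℓ=0}^{L} u_ℓ)·(Σ_{ℓ=0}^{L} v_ℓ) = Σ_{ℓ=0}^{2L} w_ℓ pointwise on S^{d−1}, then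 Σ_{ℓ=0}^{2L} ⟨ℓ⟩^{2s} β_ℓ² ‖w_ℓ‖²_{L²(S^{d−1})} ≤ C² κ² (Σ_{ℓ=0}^{L} ⟨ℓ⟩^{2s} β_ℓ² ‖u_ℓ‖²_{L²(S^{d−1})})·(Σ_{ℓ=0}^{L} ⟨ℓ⟩^{2s} β_ℓ² ‖v_ℓ‖²_{L²(S^{d−1})}). -/
open MeasureTheory MvPolynomial

/-- The square of the `L²` norm on the unit sphere of the restriction of a polynomial. -/
noncomputable def sphNormSq (d : ℕ) (p : MvPolynomial (Fin d) ℝ) : ℝ :=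
  ∫ y : Metric.sphere (0 : EuclideanSpace ℝ (Fin d)) 1,
    (sphereEval p y) ^ 2 ∂(sphereMeasure d)


abbrev EE (d : ℕ) := EuclideanSpace ℝ (Fin d)

noncomputable def ev {d : ℕ} (p : MvPolynomial (Fin d) ℝ) (x : EE d) : ℝ :=
  MvPolynomial.eval (fun i => x i) p

lemma ev_continuous {d : ℕ} (p : MvPolynomial (Fin d) ℝ) : Continuous (ev p) := by
  unfold ev
  exact (MvPolynomial.continuous_eval p).comp (by fun_prop)

instance sphereMeasure_finite (d : ℕ) : IsFiniteMeasure (sphereMeasure d) := by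
  unfold sphereMeasure; infer_instance

lemma ev_lineDeriv {d : ℕ} (p : MvPolynomial (Fin d) ℝ) (i : Fin d) (x : EE d) :
    HasLineDerivAt ℝ (ev p) (ev (pderiv i p) x) x (EuclideanSpace.single i (1 : ℝ)) := by
  unfold HasLineDerivAt
  induction p using MvPolynomial.induction_on with
  | C a => simpa [ev] using hasDerivAt_const (0 : ℝ) a
  | add p q hp hq =>
    have := hp.add hq
    simp only [ev, map_add] at this ⊢
    exact this
  | mul_X p n hp =>
    have hx : HasDerivAt (fun t : ℝ => (x + t • EuclideanSpace.single i (1 : ℝ)) n)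
        ((Pi.single i (1 : ℝ) : Fin d → ℝ) n) 0 := by
      have := ((hasDerivAt_id (0 : ℝ)).mul_const ((Pi.single i (1 : ℝ) : Fin d → ℝ) n)).const_add (x n)
      simpa [Pi.single_apply] using this
    have := hp.mul hx
    simp only [ev, Derivation.leibniz, map_add, smul_eq_mul, map_mul, eval_X, pderiv_X] at this ⊢
    refine this.congr_deriv ?_
    by_cases hni : n = i
    · subst hni; simp; ring
    · simp [hni, Pi.single_apply, Ne.symm hni]; try ring

lemma ev_smul {d m : ℕ} {p : MvPolynomial (Fin d) ℝ} (hp : p.IsHomogeneous m) (r : ℝ) (x : EE d) :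
    ev p (r • x) = r ^ m * ev p x := by
  unfold ev
  simp only [eval_eq', PiLp.smul_apply, smul_eq_mul, mul_pow, Finset.prod_mul_distrib,
    Finset.mul_sum]
  refine Finset.sum_congr rfl fun c hc => ?_
  have h := hp (mem_support_iff.mp hc)
  rw [Finset.prod_pow_eq_pow_sum]
  have h2 : ∑ i, c i = m := by
    rw [← h, Finsupp.weight_apply, Finsupp.sum_fintype] <;> simp
  rw [h2]; ring

lemma polar {d m : ℕ} {p : MvPolynomial (Fin d) ℝ} (hp : p.IsHomogeneous m) (hd : 1 ≤ d)
    (h : ℝ → ℝ)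
    (hint : IntegrableOn (fun r : ℝ => r ^ (d - 1) * (r ^ m * h r)) (Set.Ioi 0)) :
    Integrable (fun x : EE d => ev p x * h ‖x‖) ∧
    ∫ x : EE d, ev p x * h ‖x‖ = (∫ y, sphereEval p y ∂(sphereMeasure d)) *
      ∫ r in Set.Ioi (0 : ℝ), r ^ (d - 1) * (r ^ m * h r) := by
  have : NeZero d := ⟨by omega⟩
  have : Nontrivial (EE d) := by infer_instance
  have hmp := (volume : Measure (EE d)).measurePreserving_homeomorphUnitSphereProd
  have hdim : Module.finrank ℝ (EE d) = d := by simp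
  set F : Metric.sphere (0 : EE d) 1 × Set.Ioi (0 : ℝ) → ℝ :=
    fun z => sphereEval p z.1 * ((z.2 : ℝ) ^ m * h z.2) with hF
  have key : ∀ x : ({(0 : EE d)}ᶜ : Set (EE d)),
      F (homeomorphUnitSphereProd (EE d) x) = ev p x.1 * h ‖x.1‖ := by
    intro x
    have hx : ‖x.1‖ ≠ 0 := norm_ne_zero_iff.2 x.2
    have h1 : sphereEval p (homeomorphUnitSphereProd (EE d) x).1 = ev p (‖x.1‖⁻¹ • x.1) := by
      unfold sphereEval ev
      simp
    simp only [hF]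
    rw [h1, ev_smul hp]
    simp only [homeomorphUnitSphereProd_apply_snd_coe]
    rw [inv_pow]
    field_simp
  have hR : IntegrableOn (fun r : ℝ => r ^ (d - 1) * (r ^ m * h r)) (Set.Ioi 0) ↔
      Integrable (fun r : Set.Ioi (0 : ℝ) => (r : ℝ) ^ m * h r) (Measure.volumeIoiPow (d - 1)) := by
    rw [integrableOn_iff_comap_subtypeVal (by measurability), Function.comp_def, Measure.volumeIoiPow,
      integrable_withDensity_iff_integrable_smul', integrable_congr]
    · refine .of_forall ?_
      rintro ⟨x, hx : 0 < x⟩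
      simp (disch := positivity) [ENNReal.toReal_ofReal]
    · fun_prop
    · simp
  have hRv : ∫ r : Set.Ioi (0 : ℝ), ((r : ℝ) ^ m * h r) ∂(Measure.volumeIoiPow (d - 1))
      = ∫ r in Set.Ioi (0 : ℝ), r ^ (d - 1) * (r ^ m * h r) := by
    simp only [Measure.volumeIoiPow, ENNReal.ofReal]
    rw [integral_withDensity_eq_integral_smul,
        integral_subtype_comap measurableSet_Ioi fun a ↦ Real.toNNReal (a ^ (d - 1)) • (a ^ m * h a),
        setIntegral_congr_fun measurableSet_Ioi fun x hx ↦ ?_]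
    · rw [NNReal.smul_def, Real.coe_toNNReal _ (pow_nonneg (Set.mem_Ioi.1 hx).le _), smul_eq_mul]
    · exact (measurable_subtype_coe.pow_const _).real_toNNReal
  have hSint : Integrable (sphereEval p) (sphereMeasure d) := by
    have hc : Continuous (sphereEval p) := (ev_continuous p).comp continuous_subtype_val
    exact hc.integrable_of_hasCompactSupport (HasCompactSupport.of_compactSpace _)
  have hFint : Integrable F ((sphereMeasure d).prod (Measure.volumeIoiPow (d - 1))) :=
    hSint.mul_prod (hR.1 hint)
  rw [hdim] at hmp
  constructor
  · have h1 := (hmp.integrable_comp_emb (Homeomorph.measurableEmbedding _)).2 hFint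
    rw [← restrict_compl_singleton (μ := volume) (0 : EE d), ← IntegrableOn,
      integrableOn_iff_comap_subtypeVal (by measurability)]
    refine h1.congr (.of_forall fun x => ?_)
    exact key x
  · calc ∫ x : EE d, ev p x * h ‖x‖
        = ∫ x : ({(0 : EE d)}ᶜ : Set (EE d)), ev p x.1 * h ‖x.1‖ ∂(Measure.comap Subtype.val volume) := by
          rw [integral_subtype_comap (measurableSet_singleton _).compl fun x : EE d ↦ ev p x * h ‖x‖,
            restrict_compl_singleton]
      _ = ∫ z, F z ∂((sphereMeasure d).prod (Measure.volumeIoiPow (d - 1))) := by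
          refine Eq.trans ?_ (hmp.integral_comp (Homeomorph.measurableEmbedding _) F)
          exact integral_congr_ae (.of_forall fun x => (key x).symm)
      _ = _ := by
          rw [hF, integral_prod_mul (sphereEval p) (fun r : Set.Ioi (0 : ℝ) => (r : ℝ) ^ m * h r), hRv]


noncomputable def SI (d : ℕ) (p : MvPolynomial (Fin d) ℝ) : ℝ :=
  ∫ y, sphereEval p y ∂(sphereMeasure d)

lemma sphereEval_continuous {d : ℕ} (p : MvPolynomial (Fin d) ℝ) : Continuous (sphereEval p) :=
  (ev_continuous p).comp continuous_subtype_val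

lemma cont_integrable {d : ℕ} {f : Metric.sphere (0 : EuclideanSpace ℝ (Fin d)) 1 → ℝ}
    (hf : Continuous f) : Integrable f (sphereMeasure d) :=
  hf.integrable_of_hasCompactSupport (HasCompactSupport.of_compactSpace _)

lemma sphereEval_add {d : ℕ} (p q : MvPolynomial (Fin d) ℝ) (y) :
    sphereEval (p + q) y = sphereEval p y + sphereEval q y := by simp [sphereEval]
lemma sphereEval_mul {d : ℕ} (p q : MvPolynomial (Fin d) ℝ) (y) :
    sphereEval (p * q) y = sphereEval p y * sphereEval q y := by simp [sphereEval]
lemma sphereEval_sum {d : ℕ} {ι : Type*} (t : Finset ι) (p : ι → MvPolynomial (Fin d) ℝ) (y) :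
    sphereEval (∑ i ∈ t, p i) y = ∑ i ∈ t, sphereEval (p i) y := by simp [sphereEval]

lemma SI_add {d : ℕ} (p q : MvPolynomial (Fin d) ℝ) : SI d (p + q) = SI d p + SI d q := by
  unfold SI
  simp only [sphereEval_add]
  exact integral_add (cont_integrable (sphereEval_continuous p))
    (cont_integrable (sphereEval_continuous q))

lemma SI_zero {d : ℕ} : SI d 0 = 0 := by simp [SI, sphereEval]

lemma SI_C_mul {d : ℕ} (c : ℝ) (p : MvPolynomial (Fin d) ℝ) : SI d (C c * p) = c * SI d p := by
  unfold SI
  simp only [sphereEval_mul]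
  rw [← integral_const_mul]
  simp [sphereEval]

lemma SI_sum {d : ℕ} {ι : Type*} (t : Finset ι) (p : ι → MvPolynomial (Fin d) ℝ) :
    SI d (∑ i ∈ t, p i) = ∑ i ∈ t, SI d (p i) := by
  unfold SI
  simp only [sphereEval_sum]
  exact integral_finsetSum _ fun i _ => cont_integrable (sphereEval_continuous _)

noncomputable def gA (d m : ℕ) : ℝ :=
  ∫ r in Set.Ioi (0 : ℝ), r ^ (d - 1) * (r ^ m * Real.exp (-1 * r ^ 2))

lemma gA_int (d m : ℕ) :
    IntegrableOn (fun r : ℝ => r ^ (d - 1) * (r ^ m * Real.exp (-1 * r ^ 2))) (Set.Ioi 0) := by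
  have := integrableOn_rpow_mul_exp_neg_mul_sq (b := 1) one_pos (s := ((d - 1 + m : ℕ) : ℝ))
    (by have : (0 : ℝ) ≤ ((d - 1 + m : ℕ) : ℝ) := Nat.cast_nonneg _
        linarith)
  refine this.congr_fun (fun r _ => ?_) measurableSet_Ioi
  simp only [Real.rpow_natCast, pow_add]
  ring

lemma gA_pos (d m : ℕ) : 0 < gA d m := by
  unfold gA
  rw [setIntegral_pos_iff_support_of_nonneg_ae]
  · have : (Function.support fun r : ℝ => r ^ (d - 1) * (r ^ m * Real.exp (-1 * r ^ 2))) ∩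
        Set.Ioi 0 = Set.Ioi 0 := by
      apply Set.inter_eq_right.2
      intro r (hr : 0 < r)
      have : 0 < r ^ (d - 1) * (r ^ m * Real.exp (-1 * r ^ 2)) := by positivity
      exact this.ne'
    rw [this]; simp
  · filter_upwards [ae_restrict_mem measurableSet_Ioi] with r hr
    have hr : 0 < r := hr
    simp only [Pi.zero_apply]; positivity
  · exact gA_int d m

lemma normSq_ev {d : ℕ} (x : EE d) : ‖x‖ ^ 2 = ev (∑ i, X i ^ 2) x := by
  rw [EuclideanSpace.real_norm_sq_eq]; simp [ev]

lemma pderiv_normSq {d : ℕ} (i : Fin d) :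
    pderiv i (∑ j, X j ^ 2 : MvPolynomial (Fin d) ℝ) = 2 * X i := by
  rw [map_sum, Finset.sum_eq_single i]
  · simp [pderiv_pow]
  · intro j _ hj
    simp [pderiv_pow, pderiv_X_of_ne hj.symm, pderiv_X_of_ne hj]
  · simp

lemma ibp {d : ℕ} (hd : 1 ≤ d) (m : ℕ) : ∃ c : ℝ, ∀ p : MvPolynomial (Fin d) ℝ,
    p.IsHomogeneous m → ∀ i, SI d (X i * p) = c * SI d (pderiv i p) := by
  refine ⟨gA d (m - 1) / (2 * gA d (m + 1)), fun p hp i => ?_⟩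
  have hXp : (X i * p).IsHomogeneous (m + 1) := by
    rw [add_comm]; exact (isHomogeneous_X ℝ i).mul hp
  obtain ⟨i1, e1⟩ := polar hXp hd (fun r => Real.exp (-1 * r ^ 2)) (gA_int d _)
  obtain ⟨i2, e2⟩ := polar (hp.pderiv (i := i)) hd (fun r => Real.exp (-1 * r ^ 2)) (gA_int d _)
  obtain ⟨i3, -⟩ := polar hp hd (fun r => Real.exp (-1 * r ^ 2)) (gA_int d _)
  have hg : ∀ x : EE d, HasLineDerivAt ℝ (fun x : EE d => Real.exp (-1 * ‖x‖ ^ 2))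
      (-2 * (x i * Real.exp (-1 * ‖x‖ ^ 2))) x (EuclideanSpace.single i (1 : ℝ)) := by
    intro x
    simp only [normSq_ev]
    have h0 := ev_lineDeriv (∑ j, X j ^ 2 : MvPolynomial (Fin d) ℝ) i x
    unfold HasLineDerivAt at h0 ⊢
    have h1 := (h0.const_mul (-1)).exp
    refine h1.congr_deriv ?_
    rw [pderiv_normSq]
    simp [ev]
    ring
  have hmul : ∀ x : EE d, ev (X i * p) x = x i * ev p x := by intro x; simp [ev]
  have key := integral_bilinear_hasLineDerivAt_right_eq_neg_left_of_integrable
    (μ := (volume : Measure (EE d))) (B := ContinuousLinearMap.mul ℝ ℝ)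
    (f := ev p) (f' := ev (pderiv i p)) (g := fun x : EE d => Real.exp (-1 * ‖x‖ ^ 2))
    (g' := fun x => -2 * (x i * Real.exp (-1 * ‖x‖ ^ 2)))
    (v := EuclideanSpace.single i (1 : ℝ))
    (by simpa using i2)
    (by
      refine (i1.const_mul (-2)).congr (.of_forall fun x => ?_)
      simp only [hmul, ContinuousLinearMap.mul_apply']; ring)
    (by simpa using i3)
    (fun x _ => ev_lineDeriv p i x) (fun x _ => hg x)
  simp only [ContinuousLinearMap.mul_apply'] at key
  have e3 : ∫ x : EE d, ev p x * (-2 * (x i * Real.exp (-1 * ‖x‖ ^ 2)))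
      = -2 * ∫ x : EE d, ev (X i * p) x * Real.exp (-1 * ‖x‖ ^ 2) := by
    rw [← integral_const_mul]
    refine integral_congr_ae (.of_forall fun x => ?_)
    simp only [hmul]; ring
  rw [e3, e1, e2] at key
  change -2 * (SI d (X i * p) * gA d (m + 1)) = -(SI d (pderiv i p) * gA d (m - 1)) at key
  have := gA_pos d (m + 1)
  field_simp
  linarith

lemma IsHarmHom.pderiv' {d k : ℕ} {p : MvPolynomial (Fin d) ℝ} (hp : IsHarmHom d p k) (i : Fin d) :
    IsHarmHom d (pderiv i p) (k - 1) := by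
  refine ⟨hp.1.pderiv, ?_⟩
  have h := congrArg (pderiv i) hp.2
  rw [map_sum, map_zero] at h
  rw [← h]
  refine Finset.sum_congr rfl fun j _ => ?_
  have hc : ∀ q : MvPolynomial (Fin d) ℝ, pderiv i (pderiv j q) = pderiv j (pderiv i q) := by
    intro q
    have hz : ⁅(pderiv i : Derivation ℝ (MvPolynomial (Fin d) ℝ) (MvPolynomial (Fin d) ℝ)),
        (pderiv j : Derivation ℝ (MvPolynomial (Fin d) ℝ) (MvPolynomial (Fin d) ℝ))⁆ = 0 := by
      apply MvPolynomial.derivation_ext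
      intro n
      rw [Derivation.commutator_apply, pderiv_X, pderiv_X]
      simp only [Pi.single_apply]
      split_ifs <;> simp
    have := congrArg (fun D : Derivation ℝ (MvPolynomial (Fin d) ℝ) (MvPolynomial (Fin d) ℝ) => D q) hz
    simp only [Derivation.commutator_apply, Derivation.zero_apply] at this
    exact sub_eq_zero.1 this
  rw [hc, hc]

lemma orth {d : ℕ} (hd : 1 ≤ d) : ∀ (k m : ℕ) (p q : MvPolynomial (Fin d) ℝ), IsHarmHom d p k →
    q.IsHomogeneous m → m < k → SI d (p * q) = 0 := by
  intro k
  induction k with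
  | zero => intro m p q _ _ h; omega
  | succ k ih =>
    intro m p q hp hq hm
    obtain ⟨c, hc⟩ := ibp hd (k + m)
    have hE := hp.1.sum_X_mul_pderiv
    have h1 : ((k + 1 : ℕ) : ℝ) * SI d (p * q) = c * ∑ i, SI d (pderiv i p * pderiv i q) := by
      have : C ((k + 1 : ℕ) : ℝ) * (p * q) = ∑ i, X i * (pderiv i p * q) := by
        simp only [← mul_assoc, ← Finset.sum_mul]
        rw [hE]; simp [nsmul_eq_mul]
      rw [← SI_C_mul, this, SI_sum]
      have h2 : ∀ i, SI d (X i * (pderiv i p * q)) = c * SI d (pderiv i (pderiv i p * q)) :=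
        fun i => hc _ (by simpa using (hp.1.pderiv (i := i)).mul hq) i
      simp only [h2]
      rw [← Finset.mul_sum, ← SI_sum, ← SI_sum]
      congr 2
      simp only [pderiv_mul, Finset.sum_add_distrib, ← Finset.sum_mul]
      rw [hp.2]; simp
    have h3 : ∀ i, SI d (pderiv i p * pderiv i q) = 0 := by
      intro i
      rcases Nat.eq_zero_or_pos m with h0 | h0
      · subst h0
        have : q = C (q.coeff 0) := by
          rw [← totalDegree_eq_zero_iff_eq_C]
          exact Nat.le_zero.1 hq.totalDegree_le
        rw [this, pderiv_C, mul_zero, SI_zero]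
      · exact ih (m - 1) _ _ (by simpa using hp.pderiv' i) hq.pderiv (by omega)
    simp only [h3, Finset.sum_const_zero, mul_zero] at h1
    have : ((k + 1 : ℕ) : ℝ) ≠ 0 := by positivity
    exact (mul_eq_zero.1 h1).resolve_left this

noncomputable def tr {d : ℕ} (x : EE d) : MvPolynomial (Fin d) ℝ →ₐ[ℝ] MvPolynomial (Fin d) ℝ :=
  aeval (fun i => X i + C (x i))

lemma ev_tr {d : ℕ} (x y : EE d) (p : MvPolynomial (Fin d) ℝ) : ev (tr x p) y = ev p (y + x) := by
  unfold ev tr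
  induction p using MvPolynomial.induction_on with
  | C a => simp
  | add p q hp hq => rw [map_add, map_add, hp, hq, map_add]
  | mul_X p n hp => rw [map_mul, map_mul, hp, map_mul, aeval_X]; simp

lemma pderiv_tr {d : ℕ} (x : EE d) (i : Fin d) (p : MvPolynomial (Fin d) ℝ) :
    pderiv i (tr x p) = tr x (pderiv i p) := by
  unfold tr
  induction p using MvPolynomial.induction_on with
  | C a => simp
  | add p q hp hq => simp only [map_add, hp, hq]
  | mul_X p n hp =>
    simp only [map_mul, pderiv_mul, hp, map_add, aeval_X, pderiv_C, add_zero, pderiv_X]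
    by_cases hni : n = i
    · subst hni; simp
    · simp [hni, Pi.single_apply]

lemma pderiv_hc {d : ℕ} (i : Fin d) (n : ℕ) (p : MvPolynomial (Fin d) ℝ) :
    pderiv i (homogeneousComponent (n + 1) p) = homogeneousComponent n (pderiv i p) := by
  induction p using MvPolynomial.induction_on' with
  | monomial u a =>
    have h1 : (monomial u a).IsHomogeneous u.degree := isHomogeneous_monomial a rfl
    have h2 := h1.pderiv (i := i)
    rw [homogeneousComponent_of_mem h1, homogeneousComponent_of_mem h2]
    by_cases hu : u.degree = 0
    · have : u = 0 := (Finsupp.degree_eq_zero_iff u).1 hu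
      subst this
      have : (monomial (0 : Fin d →₀ ℕ)) a = C a := rfl
      simp [this]
    · split_ifs with h h' h' <;> first | rfl | omega | simp
  | add p q hp hq => simp [hp, hq]

lemma hc_harm {d : ℕ} (k : ℕ) (q : MvPolynomial (Fin d) ℝ)
    (hq : ∑ i : Fin d, pderiv i (pderiv i q) = 0) :
    IsHarmHom d (homogeneousComponent k q) k := by
  refine ⟨homogeneousComponent_isHomogeneous k q, ?_⟩
  match k with
  | 0 => simp [homogeneousComponent_zero]
  | 1 =>
    simp only [pderiv_hc 
      _ 0, homogeneousComponent_zero, pderiv_C, Finset.sum_const_zero]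
  | k + 2 =>
    simp only [pderiv_hc _ (k + 1), pderiv_hc _ k]
    rw [← map_sum, hq, map_zero]

lemma ind_int (d k : ℕ) (a b : ℝ) :
    IntegrableOn (fun ρ : ℝ => ρ ^ (d - 1) * (ρ ^ k * (Set.Ioo a b).indicator 1 ρ)) (Set.Ioi 0) := by
  apply Integrable.integrableOn
  have : (fun ρ : ℝ => ρ ^ (d - 1) * (ρ ^ k * (Set.Ioo a b).indicator 1 ρ))
      = (Set.Ioo a b).indicator (fun ρ : ℝ => ρ ^ (d - 1) * ρ ^ k) := by
    funext ρ
    by_cases h : ρ ∈ Set.Ioo a b <;> simp [h]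
  rw [this, integrable_indicator_iff measurableSet_Ioo]
  have hc : Continuous (fun ρ : ℝ => ρ ^ (d - 1) * ρ ^ k) := by fun_prop
  exact (hc.integrableOn_Icc (a := a) (b := b)).mono_set Set.Ioo_subset_Icc_self

lemma mean_value {d : ℕ} (hd : 1 ≤ d) (q : MvPolynomial (Fin d) ℝ)
    (hq : ∑ i : Fin d, pderiv i (pderiv i q) = 0) (r : ℝ) :
    ∫ y in Metric.ball (0 : EE d) r, ev q y
      = ev q 0 * (volume : Measure (EE d)).real (Metric.ball 0 r) := by
  have hball : ∀ y : EE d, ∀ f : EE d → ℝ, (Metric.ball (0 : EE d) r).indicator f y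
      = f y * (Set.Ioo (-1) r).indicator (1 : ℝ → ℝ) ‖y‖ := by
    intro y f
    have : (-1 : ℝ) < ‖y‖ := by linarith [norm_nonneg y]
    by_cases h : ‖y‖ < r <;> simp [h, this]
  have hsum : ∀ y, ev q y = ∑ k ∈ Finset.range (q.totalDegree + 1),
      ev (homogeneousComponent k q) y := by
    intro y
    conv_lhs => rw [← sum_homogeneousComponent q]
    simp [ev]
  have hP : ∀ k, _ := fun k => polar (homogeneousComponent_isHomogeneous k q) hd
    ((Set.Ioo (-1) r).indicator 1) (ind_int d k (-1) r)
  rw [← integral_indicator measurableSet_ball]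
  simp only [hball, hsum, Finset.sum_mul]
  rw [integral_finsetSum _ fun k _ => (hP k).1, Finset.sum_eq_single 0]
  · have h0 : ∀ y, ev (homogeneousComponent 0 q) y = coeff 0 q := by
      intro y; simp [ev, homogeneousComponent_zero]
    have : ∑ k ∈ Finset.range (q.totalDegree + 1), ev (homogeneousComponent k q) (0 : EE d)
        = coeff 0 q := by
      rw [Finset.sum_eq_single 0, h0]
      · intro k _ hk
        have := ev_smul (homogeneousComponent_isHomogeneous k q) 0 (0 : EE d)
        simpa [hk] using this
      · simp
    rw [← Finset.sum_mul, this]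
    simp only [h0]
    rw [← integral_indicator_one measurableSet_ball, ← integral_const_mul]
    refine integral_congr_ae (.of_forall fun y => ?_)
    simp only [hball, Pi.one_apply, one_mul]
  · intro k _ hk
    rw [(hP k).2]
    have h1 := orth hd k 0 (homogeneousComponent k q) 1 (hc_harm k q hq) (isHomogeneous_one _ _)
      (Nat.pos_of_ne_zero hk)
    rw [mul_one] at h1
    change SI d _ * _ = 0
    rw [h1, zero_mul]
  · simp

lemma ev_mul {d : ℕ} (p q : MvPolynomial (Fin d) ℝ) (x : EE d) : ev (p * q) x = ev p x * ev q x := by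
  simp [ev]

lemma sup_aux {d : ℕ} (hd : 1 ≤ d) {u : MvPolynomial (Fin d) ℝ} {k : ℕ} (hu : IsHarmHom d u k)
    (x : EE d) (hx : ‖x‖ = 1) (r : ℝ) (hr : 0 < r) :
    ev u x ^ 2 * (r ^ d * (volume : Measure (EE d)).real (Metric.ball 0 1)) ≤
      SI d (u * u) * ((1 + r) ^ (d - 1 + (k + k)) * (2 * r)) := by
  have : NeZero d := ⟨by omega⟩
  set q := tr x u with hqdef
  have hq : ∑ i : Fin d, pderiv i (pderiv i q) = 0 := by
    simp only [hqdef, pderiv_tr]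
    rw [← map_sum, hu.2, map_zero]
  have hm := mean_value hd q hq r
  have hq0 : ev q 0 = ev u x := by rw [hqdef, ev_tr]; simp
  rw [hq0] at hm
  set V := (volume : Measure (EE d)).real (Metric.ball 0 r) with hV
  have hVr : V = r ^ d * (volume : Measure (EE d)).real (Metric.ball 0 1) := by
    rw [hV, Measure.real, Measure.addHaar_ball_of_pos _ _ hr, ENNReal.toReal_mul,
      ENNReal.toReal_ofReal (by positivity)]
    simp [Measure.real]
  rw [← hVr]
  set c := ev u x
  have ballint : ∀ f : EE d → ℝ, Continuous f → IntegrableOn f (Metric.ball (0 : EE d) r) :=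
    fun f hf => (hf.continuousOn.integrableOn_compact (isCompact_closedBall (0 : EE d) r)).mono_set
      Metric.ball_subset_closedBall
  have hqc := ev_continuous q
  have h1 : c ^ 2 * V ≤ ∫ y in Metric.ball (0 : EE d) r, ev q y ^ 2 := by
    have h0 : 0 ≤ ∫ y in Metric.ball (0 : EE d) r, (ev q y - c) ^ 2 :=
      integral_nonneg fun y => sq_nonneg _
    have h2 : ∫ y in Metric.ball (0 : EE d) r, (ev q y - c) ^ 2
        = (∫ y in Metric.ball (0 : EE d) r, ev q y ^ 2)
          - (∫ y in Metric.ball (0 : EE d) r, 2 * c * ev q y)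
          + ∫ y in Metric.ball (0 : EE d) r, c ^ 2 := by
      rw [← integral_sub (ballint _ (by fun_prop)) (ballint _ (by fun_prop)),
        ← integral_add (ballint _ (by fun_prop)) (ballint _ (by fun_prop))]
      refine integral_congr_ae (.of_forall fun y => ?_)
      simp only []
      ring
    rw [integral_const_mul, hm, setIntegral_const, smul_eq_mul] at h2
    rw [h2] at h0
    change 0 ≤ _ - _ + V * c ^ 2 at h0
    linarith
  refine h1.trans ?_
  have hmul : (u * u).IsHomogeneous (k + k) := hu.1.mul hu.1
  obtain ⟨hi, he⟩ := polar hmul hd ((Set.Ioo (1 - r) (1 + r)).indicator 1) (ind_int d _ _ _)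
  have h2 : ∫ y in Metric.ball (0 : EE d) r, ev q y ^ 2 ≤
      ∫ y : EE d, ev (u * u) y * (Set.Ioo (1 - r) (1 + r)).indicator 1 ‖y‖ := by
    rw [← integral_add_right_eq_self (fun y : EE d => ev (u * u) y * (Set.Ioo (1 - r) (1 + r)).indicator 1 ‖y‖) x]
    rw [← integral_indicator measurableSet_ball]
    refine integral_mono_of_nonneg (.of_forall fun y => ?_) (hi.comp_add_right x)
      (.of_forall fun y => ?_)
    · exact Set.indicator_nonneg (fun y _ => sq_nonneg _) y
    · simp only [hqdef, ev_tr, ev_mul]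
      by_cases h : y ∈ Metric.ball (0 : EE d) r
      · have h' : ‖y‖ < r := by simpa using h
        have hmem : ‖y + x‖ ∈ Set.Ioo (1 - r) (1 + r) := by
          constructor
          · have := norm_sub_norm_le x (-y)
            rw [sub_neg_eq_add, norm_neg, hx, add_comm x y] at this
            linarith
          · have := norm_add_le y x
            linarith
        rw [Set.indicator_of_mem h, Set.indicator_of_mem hmem]
        simp [sq]
      · rw [Set.indicator_of_notMem h]
        exact mul_nonneg (mul_self_nonneg _) (Set.indicator_nonneg (fun _ _ => zero_le_one) _)
  refine h2.trans ?_
  rw [he]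
  have hSI : 0 ≤ SI d (u * u) := integral_nonneg fun y => by
    simp only [Pi.zero_apply, sphereEval_mul]; exact mul_self_nonneg _
  refine mul_le_mul_of_nonneg_left ?_ hSI
  have h3 : ∫ ρ in Set.Ioi (0 : ℝ), ρ ^ (d - 1) * (ρ ^ (k + k) * (Set.Ioo (1 - r) (1 + r)).indicator 1 ρ)
      ≤ ∫ ρ : ℝ, (Set.Ioo (1 - r) (1 + r)).indicator (fun _ => (1 + r) ^ (d - 1 + (k + k))) ρ := by
    rw [← integral_indicator measurableSet_Ioi]
    refine integral_mono_of_nonneg (.of_forall fun ρ => ?_) ?_ (.of_forall fun ρ => ?_)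
    · refine Set.indicator_nonneg (fun ρ hρ => ?_) ρ
      have : 0 < ρ := hρ
      have := Set.indicator_nonneg (s := Set.Ioo (1 - r) (1 + r)) (f := (1 : ℝ → ℝ))
        (fun _ _ => zero_le_one) ρ
      positivity
    · rw [integrable_indicator_iff measurableSet_Ioo]
      exact integrableOn_const (by simp)
    · by_cases h : ρ ∈ Set.Ioi (0 : ℝ)
      · have h0 : 0 < ρ := h
        rw [Set.indicator_of_mem h]
        by_cases h' : ρ ∈ Set.Ioo (1 - r) (1 + r)
        · rw [Set.indicator_of_mem h', Set.indicator_of_mem h', Pi.one_apply, mul_one, ← pow_add]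
          exact pow_le_pow_left₀ h0.le h'.2.le _
        · rw [Set.indicator_of_notMem h', Set.indicator_of_notMem h']; simp
      · rw [Set.indicator_of_notMem h]
        exact Set.indicator_nonneg (fun _ _ => by positivity) _
  refine h3.trans ?_
  rw [integral_indicator measurableSet_Ioo, setIntegral_const, smul_eq_mul]
  rw [Real.volume_real_Ioo_of_le (by linarith)]
  apply le_of_eq; ring

lemma sup_bound {d : ℕ} (hd : 1 ≤ d) : ∃ K : ℝ, 0 < K ∧ ∀ (k : ℕ) (u : MvPolynomial (Fin d) ℝ),
    IsHarmHom d u k → ∀ y, sphereEval u y ^ 2 ≤ K * ((k : ℝ) + 1) ^ (d - 1) * SI d (u * u) := by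
  have : NeZero d := ⟨by omega⟩
  set V := (volume : Measure (EE d)).real (Metric.ball 0 1) with hV
  have hVpos : 0 < V := by
    rw [hV, Measure.real]
    exact ENNReal.toReal_pos (Metric.measure_ball_pos _ _ one_pos).ne' measure_ball_lt_top.ne
  refine ⟨2 ^ (d - 1) * Real.exp 2 * 2 / V, by positivity, fun k u hu y => ?_⟩
  have hy : ‖(y : EE d)‖ = 1 := by simp
  have hk : (0 : ℝ) < (k : ℝ) + 1 := by positivity
  set r : ℝ := 1 / ((k : ℝ) + 1) with hr
  have hr0 : 0 < r := by positivity
  have hr1 : r ≤ 1 := by rw [hr, div_le_one hk]; linarith [(Nat.cast_nonneg k : (0 : ℝ) ≤ k)]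
  have h := sup_aux hd hu y hy r hr0
  change sphereEval u y ^ 2 * _ ≤ _ at h
  have hSI : 0 ≤ SI d (u * u) := integral_nonneg fun y => by
    simp only [Pi.zero_apply, sphereEval_mul]; exact mul_self_nonneg _
  have hb : (1 + r) ^ (d - 1 + (k + k)) ≤ 2 ^ (d - 1) * Real.exp 2 := by
    rw [pow_add]
    gcongr
    · linarith
    · calc (1 + r) ^ (k + k) ≤ (Real.exp r) ^ (k + k) := by
            gcongr; linarith [Real.add_one_le_exp r]
        _ = Real.exp ((k + k : ℕ) * r) := by rw [← Real.exp_nat_mul]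
        _ ≤ Real.exp 2 := by
            gcongr
            rw [hr]; push_cast
            rw [mul_one_div, div_le_iff₀ hk]; linarith
  have hrd : r ^ d = r * (((k : ℝ) + 1) ^ (d - 1))⁻¹ := by
    obtain ⟨e, rfl⟩ : ∃ e, d = e + 1 := ⟨d - 1, by omega⟩
    rw [pow_succ', Nat.add_sub_cancel, hr, one_div, inv_pow]
  rw [hrd] at h
  have h2 : sphereEval u y ^ 2 * (r * (((k : ℝ) + 1) ^ (d - 1))⁻¹ * V) ≤
      SI d (u * u) * (2 ^ (d - 1) * Real.exp 2 * (2 * r)) := h.trans (by gcongr)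
  have hpos : 0 < r * (((k : ℝ) + 1) ^ (d - 1))⁻¹ * V := by positivity
  refine le_of_mul_le_mul_right (h2.trans (le_of_eq ?_)) hpos
  have : ((k : ℝ) + 1) ^ (d - 1) ≠ 0 := by positivity
  field_simp

lemma SI_mono {d : ℕ} {p q : MvPolynomial (Fin d) ℝ} (h : ∀ y, sphereEval p y ≤ sphereEval q y) :
    SI d p ≤ SI d q :=
  integral_mono (cont_integrable (sphereEval_continuous p))
    (cont_integrable (sphereEval_continuous q)) h

lemma SI_congr {d : ℕ} {p q : MvPolynomial (Fin d) ℝ} (h : ∀ y, sphereEval p y = sphereEval q y) :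
    SI d p = SI d q := by
  unfold SI; exact congrArg _ (funext h)

lemma SI_sq_nonneg {d : ℕ} (u : MvPolynomial (Fin d) ℝ) : 0 ≤ SI d (u * u) :=
  integral_nonneg fun y => by
    simp only [Pi.zero_apply, sphereEval_mul]; exact mul_self_nonneg _

lemma sphNormSq_eq {d : ℕ} (u : MvPolynomial (Fin d) ℝ) : sphNormSq d u = SI d (u * u) := by
  unfold sphNormSq SI
  simp only [sphereEval_mul, sq]

lemma orth_ne {d : ℕ} (hd : 1 ≤ d) {k m : ℕ} {p q : MvPolynomial (Fin d) ℝ} (hp : IsHarmHom d p k)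
    (hq : IsHarmHom d q m) (h : k ≠ m) : SI d (p * q) = 0 := by
  rcases lt_or_gt_of_ne h with h | h
  · rw [mul_comm]; exact orth hd m k q p hq hp.1 h
  · exact orth hd k m p q hp hq.1 h

lemma pyth {d : ℕ} (hd : 1 ≤ d) (t : Finset ℕ) (v : ℕ → MvPolynomial (Fin d) ℝ)
    (hv : ∀ l ∈ t, IsHarmHom d (v l) l) :
    SI d ((∑ j ∈ t, v j) * (∑ j ∈ t, v j)) = ∑ j ∈ t, SI d (v j * v j) := by
  rw [Finset.sum_mul_sum, SI_sum]
  refine Finset.sum_congr rfl fun i hi => ?_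
  rw [SI_sum, Finset.sum_eq_single i]
  · intro j hj hji
    exact orth_ne hd (hv i hi) (hv j hj) hji.symm
  · intro h; exact absurd hi h

def JJ (P : ℕ → ℕ → Prop) [DecidableRel P] (L k i : ℕ) : Finset ℕ :=
  (Finset.range (L + 1)).filter (fun j => P i j ∧ k ≤ i + j ∧ j ≤ k + i)

noncomputable def WW (s : ℝ) (β : ℕ → ℝ) (k : ℕ) : ℝ := (1 + (k : ℝ) ^ 2) ^ s * (β k) ^ 2

lemma WW_pos {s : ℝ} {β : ℕ → ℝ} (hβ : ∀ l, 0 < β l) (k : ℕ) : 0 < WW s β k := by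
  unfold WW
  have := hβ k
  positivity

lemma WW_le {s κ : ℝ} {β : ℕ → ℝ} (hs : 0 < s) (hβ : ∀ l, 0 < β l)
    (hκ : ∀ i j k : ℕ, k ≤ i + j → β k ≤ κ * β i * β j) {i j k : ℕ} (hij : i ≤ j)
    (hk : k ≤ i + j) :
    WW s β k ≤ 4 ^ s * κ ^ 2 * ((1 + (i : ℝ) ^ 2) ^ (-s)) * WW s β i * WW s β j := by
  have hi0 : (0 : ℝ) < 1 + (i : ℝ) ^ 2 := by positivity
  have hj0 : (0 : ℝ) < 1 + (j : ℝ) ^ 2 := by positivity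
  have e : (1 + (i : ℝ) ^ 2) ^ (-s) * (1 + (i : ℝ) ^ 2) ^ s = 1 := by
    rw [← Real.rpow_add hi0]; simp
  have h1 : (1 + (k : ℝ) ^ 2) ^ s ≤ 4 ^ s * (1 + (j : ℝ) ^ 2) ^ s := by
    rw [← Real.mul_rpow (by norm_num) hj0.le]
    refine Real.rpow_le_rpow (by positivity) ?_ hs.le
    have : (k : ℝ) ≤ 2 * j := by
      have : k ≤ 2 * j := by omega
      exact_mod_cast this
    have hk0 : (0 : ℝ) ≤ k := Nat.cast_nonneg _
    nlinarith
  have h2 : β k ^ 2 ≤ (κ * β i * β j) ^ 2 := pow_le_pow_left₀ (hβ k).le (hκ i j k hk) 2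
  unfold WW
  calc (1 + (k : ℝ) ^ 2) ^ s * β k ^ 2
      ≤ (4 ^ s * (1 + (j : ℝ) ^ 2) ^ s) * (κ * β i * β j) ^ 2 := by gcongr
    _ = 4 ^ s * κ ^ 2 * 1 * (β i) ^ 2 * ((1 + (j : ℝ) ^ 2) ^ s * β j ^ 2) := by ring
    _ = 4 ^ s * κ ^ 2 * ((1 + (i : ℝ) ^ 2) ^ (-s) * (1 + (i : ℝ) ^ 2) ^ s) * (β i) ^ 2 *
        ((1 + (j : ℝ) ^ 2) ^ s * β j ^ 2) := by rw [e]
    _ = _ := by ring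

lemma half {d : ℕ} (hd : 1 ≤ d) {K : ℝ} (hK : 0 < K)
    (hsup : ∀ (k : ℕ) (u : MvPolynomial (Fin d) ℝ), IsHarmHom d u k →
      ∀ y, sphereEval u y ^ 2 ≤ K * ((k : ℝ) + 1) ^ (d - 1) * SI d (u * u))
    {s κ S : ℝ} (hs : 0 < s) {β : ℕ → ℝ} (hβ : ∀ l, 0 < β l)
    (hκ : ∀ i j k : ℕ, k ≤ i + j → β k ≤ κ * β i * β j)
    (L : ℕ) (hS : ∑ i ∈ Finset.range (L + 1),
      ((i : ℝ) + 1) ^ (d - 1) * (1 + (i : ℝ) ^ 2) ^ (-s) * (2 * i + 1) ≤ S)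
    (u v : ℕ → MvPolynomial (Fin d) ℝ)
    (hu : ∀ l ≤ L, IsHarmHom d (u l) l) (hv : ∀ l ≤ L, IsHarmHom d (v l) l)
    (P : ℕ → ℕ → Prop) [DecidableRel P] (hP : ∀ i j, P i j → i ≤ j) :
    ∑ k ∈ Finset.range (2 * L + 1), WW s β k *
      SI d ((∑ i ∈ Finset.range (L + 1), u i * ∑ j ∈ JJ P L k i, v j) *
        (∑ i ∈ Finset.range (L + 1), u i * ∑ j ∈ JJ P L k i, v j))
    ≤ 4 ^ s * κ ^ 2 * K * S * (∑ l ∈ Finset.range (L + 1), WW s β l * SI d (u l * u l)) *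
      (∑ l ∈ Finset.range (L + 1), WW s β l * SI d (v l * v l)) := by
  set A := ∑ l ∈ Finset.range (L + 1), WW s β l * SI d (u l * u l) with hA
  set B := ∑ l ∈ Finset.range (L + 1), WW s β l * SI d (v l * v l) with hB
  set W := WW s β with hW
  have hWpos : ∀ k, 0 < W k := WW_pos hβ
  have hA0 : 0 ≤ A := Finset.sum_nonneg fun l _ => mul_nonneg (hWpos l).le (SI_sq_nonneg _)
  have hB0 : 0 ≤ B := Finset.sum_nonneg fun l _ => mul_nonneg (hWpos l).le (SI_sq_nonneg _)
  set Ki : ℕ → ℝ := fun i => K * ((i : ℝ) + 1) ^ (d - 1) with hKi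
  have hKpos : ∀ i, 0 < Ki i := fun i => by simp only [hKi]; positivity
  set c : ℕ → ℝ := fun i => ((i : ℝ) + 1) ^ (d - 1) * (1 + (i : ℝ) ^ 2) ^ (-s) with hc
  have hc0 : ∀ i, 0 ≤ c i := fun i => by simp only [hc]; positivity
  -- step 1: bound for each k
  have step1 : ∀ k, SI d ((∑ i ∈ Finset.range (L + 1), u i * ∑ j ∈ JJ P L k i, v j) *
        (∑ i ∈ Finset.range (L + 1), u i * ∑ j ∈ JJ P L k i, v j)) ≤
      A * ∑ i ∈ Finset.range (L + 1), Ki i / W i * ∑ j ∈ JJ P L k i, SI d (v j * v j) := by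
    intro k
    have hp : ∀ i, ∑ j ∈ JJ P L k i, SI d (v j * v j)
        = SI d ((∑ j ∈ JJ P L k i, v j) * (∑ j ∈ JJ P L k i, v j)) := by
      intro i
      refine (pyth hd _ v fun l hl => hv l ?_).symm
      have := (Finset.mem_filter.1 hl).1
      have := Finset.mem_range.1 this
      omega
    simp only [hp, ← SI_C_mul]
    rw [← SI_sum, ← SI_C_mul]
    apply SI_mono
    intro y
    have hCe : ∀ a : ℝ, sphereEval (C a : MvPolynomial (Fin d) ℝ) y = a := by
      intro a; simp [sphereEval]
    simp only [sphereEval_mul, sphereEval_sum, hCe]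
    have cs := Finset.sum_sq_le_sum_mul_sum_of_sq_eq_mul (Finset.range (L + 1))
      (r := fun i => sphereEval (u i) y * ∑ j ∈ JJ P L k i, sphereEval (v j) y)
      (f := fun i => W i / Ki i * sphereEval (u i) y ^ 2)
      (g := fun i => Ki i / W i * ((∑ j ∈ JJ P L k i, sphereEval (v j) y) *
        (∑ j ∈ JJ P L k i, sphereEval (v j) y)))
      (fun i _ => mul_nonneg (div_pos (hWpos i) (hKpos i)).le (sq_nonneg _))
      (fun i _ => mul_nonneg (div_pos (hKpos i) (hWpos i)).le (mul_self_nonneg _))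
      (fun i _ => by
        have h1 := (hWpos i).ne'
        have h2 := (hKpos i).ne'
        field_simp)
    rw [← sq]
    refine cs.trans ?_
    refine mul_le_mul_of_nonneg_right ?_ (Finset.sum_nonneg fun i _ =>
      mul_nonneg (div_pos (hKpos i) (hWpos i)).le (mul_self_nonneg _))
    rw [hA]
    refine Finset.sum_le_sum fun i hi => ?_
    have hiL : i ≤ L := by have := Finset.mem_range.1 hi; omega
    have h1 := hsup i (u i) (hu i hiL) y
    have h2 := hKpos i
    have h3 := hWpos i
    calc W i / Ki i * sphereEval (u i) y ^ 2 ≤ W i / Ki i * (Ki i * SI d (u i * u i)) := by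
          gcongr
      _ = W i * SI d (u i * u i) := by field_simp
  -- step 2
  have step2 : ∀ k, W k * SI d ((∑ i ∈ Finset.range (L + 1), u i * ∑ j ∈ JJ P L k i, v j) *
        (∑ i ∈ Finset.range (L + 1), u i * ∑ j ∈ JJ P L k i, v j)) ≤
      (4 ^ s * κ ^ 2 * K * A) * ∑ i ∈ Finset.range (L + 1), c i *
        ∑ j ∈ JJ P L k i, W j * SI d (v j * v j) := by
    intro k
    refine (mul_le_mul_of_nonneg_left (step1 k) (hWpos k).le).trans ?_
    rw [mul_left_comm, mul_comm (4 ^ s * κ ^ 2 * K) A, mul_assoc A]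
    refine mul_le_mul_of_nonneg_left ?_ hA0
    simp only [Finset.mul_sum]
    refine Finset.sum_le_sum fun i hi => Finset.sum_le_sum fun j hj => ?_
    obtain ⟨-, hPij, hk, -⟩ := Finset.mem_filter.1 hj
    have h1 := WW_le hs hβ hκ (hP i j hPij) hk
    have h2 := hKpos i
    have h3 := hWpos i
    have h4 := SI_sq_nonneg (v j)
    have h5 := hWpos k
    calc W k * (Ki i / W i * SI d (v j * v j))
        ≤ (4 ^ s * κ ^ 2 * ((1 + (i : ℝ) ^ 2) ^ (-s)) * W i * W j) *
          (Ki i / W i * SI d (v j * v j)) := by gcongr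
      _ = _ := by
        simp only [hKi, hc]
        field_simp
  refine (Finset.sum_le_sum fun k _ => step2 k).trans ?_
  rw [← Finset.mul_sum, Finset.sum_comm]
  have step3 : ∀ i, ∑ k ∈ Finset.range (2 * L + 1), ∑ j ∈ JJ P L k i, W j * SI d (v j * v j)
      ≤ (2 * (i : ℝ) + 1) * B := by
    intro i
    have : ∀ k, ∑ j ∈ JJ P L k i, W j * SI d (v j * v j) ≤
        ∑ j ∈ Finset.range (L + 1), if k ∈ Finset.Icc (j - i) (j + i) then
          W j * SI d (v j * v j) else 0 := by
      intro k
      rw [← Finset.sum_filter]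
      refine Finset.sum_le_sum_of_subset_of_nonneg ?_ fun j _ _ =>
        mul_nonneg (hWpos j).le (SI_sq_nonneg _)
      intro j hj
      obtain ⟨h1, -, h2, h3⟩ := Finset.mem_filter.1 hj
      refine Finset.mem_filter.2 ⟨h1, Finset.mem_Icc.2 ⟨by omega, by omega⟩⟩
    refine (Finset.sum_le_sum fun k _ => this k).trans ?_
    rw [Finset.sum_comm, hB, Finset.mul_sum]
    refine Finset.sum_le_sum fun j _ => ?_
    rw [← Finset.sum_filter, Finset.sum_const, nsmul_eq_mul]
    refine mul_le_mul_of_nonneg_right ?_ (mul_nonneg (hWpos j).le (SI_sq_nonneg _))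
    have hcard : ((Finset.range (2 * L + 1)).filter
        (fun k => k ∈ Finset.Icc (j - i) (j + i))).card ≤ 2 * i + 1 := by
      calc _ ≤ (Finset.Icc (j - i) (j + i)).card :=
            Finset.card_le_card fun k hk => (Finset.mem_filter.1 hk).2
        _ ≤ 2 * i + 1 := by rw [Nat.card_Icc]; omega
    exact_mod_cast hcard
  have h0 : 0 ≤ 4 ^ s * κ ^ 2 * K * A := by positivity
  calc _ ≤ (4 ^ s * κ ^ 2 * K * A) * ∑ i ∈ Finset.range (L + 1), c i * ((2 * (i : ℝ) + 1) * B) := by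
        refine mul_le_mul_of_nonneg_left (Finset.sum_le_sum fun i _ => ?_) h0
        rw [← Finset.mul_sum]
        exact mul_le_mul_of_nonneg_left (step3 i) (hc0 i)
    _ = (4 ^ s * κ ^ 2 * K * A) * ((∑ i ∈ Finset.range (L + 1), c i * (2 * (i : ℝ) + 1)) * B) := by
        rw [Finset.sum_mul]; simp only [mul_assoc]
    _ ≤ (4 ^ s * κ ^ 2 * K * A) * (S * B) := by gcongr
    _ = _ := by ring

lemma S_exists {d : ℕ} (hd : 1 ≤ d) {s : ℝ} (hs : (d : ℝ) / 2 + 1 / 2 < s) :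
    ∃ S : ℝ, 0 < S ∧ ∀ L : ℕ, ∑ i ∈ Finset.range (L + 1),
      ((i : ℝ) + 1) ^ (d - 1) * (1 + (i : ℝ) ^ 2) ^ (-s) * (2 * i + 1) ≤ S := by
  have hs0 : 0 < s := by
    have : (0 : ℝ) ≤ d := Nat.cast_nonneg _
    linarith
  have hsum : Summable (fun i : ℕ => 2 ^ s * 2 * ((i : ℝ) + 1) ^ ((d : ℝ) - 2 * s)) := by
    have h1 : Summable (fun n : ℕ => (n : ℝ) ^ ((d : ℝ) - 2 * s)) :=
      Real.summable_nat_rpow.2 (by linarith)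
    have h2 := (summable_nat_add_iff 1).2 h1
    refine (h2.mul_left (2 ^ s * 2)).congr fun i => ?_
    push_cast; rfl
  have hnn : ∀ i : ℕ, 0 ≤ 2 ^ s * 2 * ((i : ℝ) + 1) ^ ((d : ℝ) - 2 * s) := fun i => by positivity
  refine ⟨(∑' i : ℕ, 2 ^ s * 2 * ((i : ℝ) + 1) ^ ((d : ℝ) - 2 * s)) + 1, by
    have : 0 ≤ ∑' i : ℕ, 2 ^ s * 2 * ((i : ℝ) + 1) ^ ((d : ℝ) - 2 * s) := tsum_nonneg hnn
    linarith, fun L => ?_⟩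
  have h3 := hsum.sum_le_tsum (Finset.range (L + 1)) fun i _ => hnn i
  refine le_trans (Finset.sum_le_sum fun i _ => ?_) (h3.trans (by linarith))
  have hi : (0 : ℝ) < (i : ℝ) + 1 := by positivity
  have h4 : (1 + (i : ℝ) ^ 2) ^ (-s) ≤ 2 ^ s * ((i : ℝ) + 1) ^ (-2 * s) := by
    have e1 : (2 : ℝ) ^ s * ((i : ℝ) + 1) ^ (-2 * s) = (((i : ℝ) + 1) ^ 2 / 2) ^ (-s) := by
      rw [Real.div_rpow (by positivity) (by norm_num), Real.rpow_neg (by norm_num : (0 : ℝ) ≤ 2),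
        ← Real.rpow_natCast, ← Real.rpow_mul hi.le, div_inv_eq_mul, mul_comm]
      congr 2
      push_cast; ring
    rw [e1]
    refine Real.rpow_le_rpow_of_nonpos (by positivity) ?_ (by linarith)
    nlinarith [sq_nonneg ((i : ℝ) - 1)]
  have e2 : ((i : ℝ) + 1) ^ ((d : ℝ) - 2 * s)
      = ((i : ℝ) + 1) ^ (d - 1) * ((i : ℝ) + 1) ^ (-2 * s) * ((i : ℝ) + 1) := by
    rw [← Real.rpow_natCast, ← Real.rpow_add hi]
    rw [← Real.rpow_add_one hi.ne']
    congr 1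
    rw [Nat.cast_sub hd]; push_cast; ring
  rw [e2]
  calc ((i : ℝ) + 1) ^ (d - 1) * (1 + (i : ℝ) ^ 2) ^ (-s) * (2 * i + 1)
      ≤ ((i : ℝ) + 1) ^ (d - 1) * (2 ^ s * ((i : ℝ) + 1) ^ (-2 * s)) * (2 * (i + 1)) := by
        gcongr
        linarith
    _ = _ := by ring

theorem stmt1 (d : ℕ) (hd : 2 ≤ d) (s : ℝ) (hs : (d : ℝ) / 2 + 1 / 2 < s) :
    ∃ C : ℝ, 0 < C ∧
      ∀ κ : ℝ, 0 < κ →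
      ∀ β : ℕ → ℝ, (∀ ℓ, 0 < β ℓ) →
        (∀ i j k : ℕ, k ≤ i + j → β k ≤ κ * β i * β j) →
      ∀ (L : ℕ) (u v w : ℕ → MvPolynomial (Fin d) ℝ),
        (∀ ℓ ≤ L, IsHarmHom d (u ℓ) ℓ) →
        (∀ ℓ ≤ L, IsHarmHom d (v ℓ) ℓ) →
        (∀ ℓ ≤ 2 * L, IsHarmHom d (w ℓ) ℓ) →
        (∀ y : Metric.sphere (0 : EuclideanSpace ℝ (Fin d)) 1,
          (∑ ℓ ∈ Finset.range (L + 1), sphereEval (u ℓ) y) *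
            (∑ ℓ ∈ Finset.range (L + 1), sphereEval (v ℓ) y)
            = ∑ ℓ ∈ Finset.range (2 * L + 1), sphereEval (w ℓ) y) →
        ∑ ℓ ∈ Finset.range (2 * L + 1),
            (1 + (ℓ : ℝ) ^ 2) ^ s * (β ℓ) ^ 2 * sphNormSq d (w ℓ)
          ≤ C ^ 2 * κ ^ 2 *
            (∑ ℓ ∈ Finset.range (L + 1),
              (1 + (ℓ : ℝ) ^ 2) ^ s * (β ℓ) ^ 2 * sphNormSq d (u ℓ)) *
            (∑ ℓ ∈ Finset.range (L + 1),
              (1 + (ℓ : ℝ) ^ 2) ^ s * (β ℓ) ^ 2 * sphNormSq d (v ℓ)) := by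
  have hd1 : 1 ≤ d := by omega
  have hs0 : 0 < s := by
    have : (0 : ℝ) ≤ d := Nat.cast_nonneg _
    linarith
  obtain ⟨K, hK, hsup⟩ := sup_bound hd1
  obtain ⟨S, hS, hSL⟩ := S_exists hd1 hs
  refine ⟨Real.sqrt (4 * 4 ^ s * K * S), by positivity, ?_⟩
  intro κ hκ0 β hβ hκ L u v w hu hv hw huvw
  rw [Real.sq_sqrt (by positivity)]
  simp only [sphNormSq_eq]
  have H1 := half hd1 hK hsup hs0 hβ hκ L (hSL L) u v hu hv (fun i j => i ≤ j) (fun _ _ h => h)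
  have H2 := half hd1 hK hsup hs0 hβ hκ L (hSL L) v u hv hu (fun i j => i < j) (fun _ _ h => h.le)
  set F1 : ℕ → MvPolynomial (Fin d) ℝ := fun k =>
    ∑ i ∈ Finset.range (L + 1), u i * ∑ j ∈ JJ (fun i j => i ≤ j) L k i, v j with hF1
  set F2 : ℕ → MvPolynomial (Fin d) ℝ := fun k =>
    ∑ i ∈ Finset.range (L + 1), v i * ∑ j ∈ JJ (fun i j => i < j) L k i, u j with hF2
  have hle : ∀ {l : ℕ}, l ∈ Finset.range (L + 1) → l ≤ L := fun h => by
    have := Finset.mem_range.1 h; omega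
  have key : ∀ k ∈ Finset.range (2 * L + 1), SI d (w k * w k) ≤
      2 * SI d (F1 k * F1 k) + 2 * SI d (F2 k * F2 k) := by
    intro k hk
    have hk' : k ≤ 2 * L := by have := Finset.mem_range.1 hk; omega
    have a1 : SI d (w k * ∑ l ∈ Finset.range (2 * L + 1), w l) = SI d (w k * w k) := by
      rw [Finset.mul_sum, SI_sum, Finset.sum_eq_single k]
      · intro l hl hlk
        have hl' : l ≤ 2 * L := by have := Finset.mem_range.1 hl; omega
        exact orth_ne hd1 (hw k hk') (hw l hl') hlk.symm
      · intro h; exact absurd hk h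
    have a2 : SI d (w k * ∑ l ∈ Finset.range (2 * L + 1), w l) =
        ∑ i ∈ Finset.range (L + 1), ∑ j ∈ Finset.range (L + 1), SI d (w k * (u i * v j)) := by
      have : SI d (w k * ∑ l ∈ Finset.range (2 * L + 1), w l) =
          SI d (w k * ((∑ i ∈ Finset.range (L + 1), u i) * ∑ j ∈ Finset.range (L + 1), v j)) := by
        apply SI_congr
        intro y
        simp only [sphereEval_mul, sphereEval_sum]
        rw [huvw y]
      rw [this, Finset.sum_mul_sum, Finset.mul_sum, SI_sum]
      refine Finset.sum_congr rfl fun i _ => ?_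
      rw [Finset.mul_sum, SI_sum]
    have a3 : SI d (w k * F1 k) = ∑ i ∈ Finset.range (L + 1), ∑ j ∈ Finset.range (L + 1),
        if i ≤ j ∧ k ≤ i + j ∧ j ≤ k + i then SI d (w k * (u i * v j)) else 0 := by
      rw [hF1]
      simp only []
      rw [Finset.mul_sum, SI_sum]
      refine Finset.sum_congr rfl fun i _ => ?_
      rw [Finset.mul_sum, Finset.mul_sum, SI_sum, ← Finset.sum_filter]
      rfl
    have a4 : SI d (w k * F2 k) = ∑ i ∈ Finset.range (L + 1), ∑ j ∈ Finset.range (L + 1),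
        if j < i ∧ k ≤ j + i ∧ i ≤ k + j then SI d (w k * (u i * v j)) else 0 := by
      rw [hF2, Finset.sum_comm]
      simp only []
      rw [Finset.mul_sum, SI_sum]
      refine Finset.sum_congr rfl fun j _ => ?_
      rw [Finset.mul_sum, Finset.mul_sum, SI_sum, ← Finset.sum_filter]
      refine Finset.sum_congr rfl fun i _ => ?_
      rw [mul_comm (v j)]
    have a5 : SI d (w k * w k) = SI d (w k * F1 k) + SI d (w k * F2 k) := by
      rw [← a1, a2, a3, a4, ← Finset.sum_add_distrib]
      refine Finset.sum_congr rfl fun i hi => ?_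
      rw [← Finset.sum_add_distrib]
      refine Finset.sum_congr rfl fun j hj => ?_
      have hi' := hu i (hle hi)
      have hj' := hv j (hle hj)
      have hkk := hw k hk'
      by_cases c1 : k ≤ i + j
      · by_cases c2 : j ≤ k + i
        · by_cases c3 : i ≤ k + j
          · by_cases c4 : i ≤ j
            · rw [if_pos ⟨c4, c1, c2⟩, if_neg (by omega), add_zero]
            · rw [if_neg (by omega), if_pos (by omega), zero_add]
          · have : SI d (w k * (u i * v j)) = 0 := by
              rw [show w k * (u i * v j) = u i * (w k * v j) by ring]
              exact orth hd1 i (k + j) _ _ hi' (hkk.1.mul hj'.1) (by omega)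
            simp [this]
        · have : SI d (w k * (u i * v j)) = 0 := by
            rw [show w k * (u i * v j) = v j * (w k * u i) by ring]
            exact orth hd1 j (k + i) _ _ hj' (hkk.1.mul hi'.1) (by omega)
          simp [this]
      · have : SI d (w k * (u i * v j)) = 0 :=
          orth hd1 k (i + j) _ _ hkk (hi'.1.mul hj'.1) (by omega)
        simp [this]
    have a6 : SI d (C 2 * (w k * F1 k) + C 2 * (w k * F2 k)) ≤
        SI d (w k * w k + (C 2 * (F1 k * F1 k) + C 2 * (F2 k * F2 k))) := by
      apply SI_mono
      intro y
      have hC : sphereEval (C 2 : MvPolynomial (Fin d) ℝ) y = 2 := by simp [sphereEval]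
      simp only [sphereEval_add, sphereEval_mul, hC]
      nlinarith [sq_nonneg (sphereEval (w k) y - sphereEval (F1 k) y - sphereEval (F2 k) y),
        sq_nonneg (sphereEval (F1 k) y - sphereEval (F2 k) y)]
    simp only [SI_add, SI_C_mul] at a6
    linarith
  have hfin : ∑ k ∈ Finset.range (2 * L + 1), WW s β k * SI d (w k * w k) ≤
      2 * (∑ k ∈ Finset.range (2 * L + 1), WW s β k * SI d (F1 k * F1 k)) +
      2 * (∑ k ∈ Finset.range (2 * L + 1), WW s β k * SI d (F2 k * F2 k)) := by
    rw [Finset.mul_sum, Finset.mul_sum, ← Finset.sum_add_distrib]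
    refine Finset.sum_le_sum fun k hk => ?_
    have := mul_le_mul_of_nonneg_left (key k hk) (WW_pos (s := s) hβ k).le
    linarith
  change ∑ k ∈ Finset.range (2 * L + 1), WW s β k * SI d (w k * w k) ≤
    4 * 4 ^ s * K * S * κ ^ 2 *
      (∑ l ∈ Finset.range (L + 1), WW s β l * SI d (u l * u l)) *
      (∑ l ∈ Finset.range (L + 1), WW s β l * SI d (v l * v l))
  refine hfin.trans ?_
  refine (add_le_add (mul_le_mul_of_nonneg_left H1 zero_le_two)
    (mul_le_mul_of_nonneg_left H2 zero_le_two)).trans (le_of_eq ?_)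
  ring
end

section
/- Let A be a 2×2 complex matrix, regarded as the bilinear form A(ξ,η) = ξᵀAη on ℂ². Define A♭ = M₁ A M₂, where M₁ is the matrix with rows (−1, i) and (−1, −i), and M₂ is the matrix with columns (−1, i)ᵀ and (−1, −i)ᵀ, and for k ∈ ℤ set ζ(k) = (−|k|, ik) ∈ ℂ². Then the following three conditions are equivalent: (1) both diagonal entries of A♭ are zero; (2) for all j, k ∈ ℤ with jk ≥ 0, A(ζ(j), ζ(k)) = 0; (3) A satisfies the elliptic null condition, i.e. for every ξ = (ξ₁, ξ₂) ∈ ℂ², ξ₁² + ξ₂² = 0 implies A(ξ, ξ) = 0. -/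
open Matrix Complex

/-- The bilinear form on `ℂ²` associated to a `2 × 2` complex matrix: `A(ξ,η) = ξᵀ A η`. -/
noncomputable def bilM (A : Matrix (Fin 2) (Fin 2) ℂ) (ξ η : Fin 2 → ℂ) : ℂ :=
  ∑ i : Fin 2, ∑ j : Fin 2, ξ i * A i j * η j

/-- The vector `ζ(k) = (−|k|, ik) ∈ ℂ²`. -/
noncomputable def zetaVec (k : ℤ) : Fin 2 → ℂ :=
  ![((-(|k|) : ℤ) : ℂ), Complex.I * (k : ℂ)]

/-- The matrix `A♭ = M₁ A M₂` with `M₁` having rows `(−1, i)`, `(−1, −i)` and `M₂` having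
columns `(−1, i)ᵀ`, `(−1, −i)ᵀ`. -/
noncomputable def flatM (A : Matrix (Fin 2) (Fin 2) ℂ) : Matrix (Fin 2) (Fin 2) ℂ :=
  !![(-1 : ℂ), Complex.I; (-1 : ℂ), -Complex.I] * A *
    !![(-1 : ℂ), (-1 : ℂ); Complex.I, -Complex.I]

theorem aux_f0 (A : Matrix (Fin 2) (Fin 2) ℂ) :
    flatM A 0 0 = A 0 0 - A 1 1 - Complex.I * (A 0 1 + A 1 0) := by
  simp [flatM, Matrix.mul_apply, Matrix.vecMul, dotProduct, Fin.sum_univ_two]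
  linear_combination (A 1 1) * Complex.I_sq

theorem aux_f1 (A : Matrix (Fin 2) (Fin 2) ℂ) :
    flatM A 1 1 = A 0 0 - A 1 1 + Complex.I * (A 0 1 + A 1 0) := by
  simp [flatM, Matrix.mul_apply, Matrix.vecMul, dotProduct, Fin.sum_univ_two]
  linear_combination (A 1 1) * Complex.I_sq

theorem aux_bil (A : Matrix (Fin 2) (Fin 2) ℂ) (x y : Fin 2 → ℂ) :
    bilM A x y = x 0 * A 0 0 * y 0 + x 0 * A 0 1 * y 1 + x 1 * A 1 0 * y 0
      + x 1 * A 1 1 * y 1 := by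
  simp [bilM, Fin.sum_univ_two]
  ring

theorem aux_pos (A : Matrix (Fin 2) (Fin 2) ℂ) (j k : ℤ) (hj : 0 ≤ j) (hk : 0 ≤ k) :
    bilM A (zetaVec j) (zetaVec k) = j * k * flatM A 0 0 := by
  rw [aux_bil, aux_f0]
  simp only [zetaVec, abs_of_nonneg hj, abs_of_nonneg hk]
  simp
  linear_combination (j * k * A 1 1) * Complex.I_sq

theorem aux_neg (A : Matrix (Fin 2) (Fin 2) ℂ) (j k : ℤ) (hj : j ≤ 0) (hk : k ≤ 0) :
    bilM A (zetaVec j) (zetaVec k) = j * k * flatM A 1 1 := by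
  rw [aux_bil, aux_f1]
  simp only [zetaVec, abs_of_nonpos hj, abs_of_nonpos hk]
  simp
  linear_combination (j * k * A 1 1) * Complex.I_sq

theorem aux_12 (A : Matrix (Fin 2) (Fin 2) ℂ) :
    (flatM A 0 0 = 0 ∧ flatM A 1 1 = 0) ↔
      (∀ j k : ℤ, 0 ≤ j * k → bilM A (zetaVec j) (zetaVec k) = 0) := by
  constructor
  · rintro ⟨h0, h1⟩ j k hjk
    rcases mul_nonneg_iff.1 hjk with ⟨a, b⟩ | ⟨a, b⟩
    · rw [aux_pos A j k a b, h0, mul_zero]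
    · rw [aux_neg A j k a b, h1, mul_zero]
  · intro h
    have h0 := h 1 1 (by norm_num)
    have h1 := h (-1) (-1) (by norm_num)
    rw [aux_pos A _ _ (by norm_num) (by norm_num)] at h0
    rw [aux_neg A _ _ (by norm_num) (by norm_num)] at h1
    exact ⟨by simpa using h0, by simpa using h1⟩

theorem aux_13 (A : Matrix (Fin 2) (Fin 2) ℂ) :
    (flatM A 0 0 = 0 ∧ flatM A 1 1 = 0) ↔
      (∀ ξ : Fin 2 → ℂ, ξ 0 ^ 2 + ξ 1 ^ 2 = 0 → bilM A ξ ξ = 0) := by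
  rw [aux_f0, aux_f1]
  constructor
  · rintro ⟨h0, h1⟩ x hx
    rw [aux_bil]
    have hs : A 0 0 - A 1 1 = 0 := by linear_combination (h0 + h1) / 2
    have ht : A 0 1 + A 1 0 = 0 := by
      have : Complex.I * (A 0 1 + A 1 0) = 0 := by linear_combination (h1 - h0) / 2
      simpa using this
    linear_combination (x 0) ^ 2 * hs + x 0 * x 1 * ht + A 1 1 * hx
  · intro h
    have h0 := h ![-1, Complex.I] (by simp)
    have h1 := h ![-1, -Complex.I] (by simp)
    rw [aux_bil] at h0 h1
    simp at h0 h1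
    constructor
    · linear_combination h0 - A 1 1 * Complex.I_sq
    · linear_combination h1 - A 1 1 * Complex.I_sq

theorem stmt3 (A : Matrix (Fin 2) (Fin 2) ℂ) :
    ((flatM A 0 0 = 0 ∧ flatM A 1 1 = 0) ↔
      (∀ j k : ℤ, 0 ≤ j * k → bilM A (zetaVec j) (zetaVec k) = 0)) ∧
    ((∀ j k : ℤ, 0 ≤ j * k → bilM A (zetaVec j) (zetaVec k) = 0) ↔
      (∀ ξ : Fin 2 → ℂ, ξ 0 ^ 2 + ξ 1 ^ 2 = 0 → bilM A ξ ξ = 0)) := by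
  exact ⟨aux_12 A, (aux_12 A).symm.trans (aux_13 A)⟩
end
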